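/- Let s ∈ ℂ with Re(s) > −1/2. For every x₀ > 0, the probability that the largest eigenvalue from the generalized Cauchy ensemble, divided by N, is at most x₀, converges to F_∞(x₀) as N → ∞; explicitly, (∫_{(−∞, N·x₀)^N} ∏_{1≤j<k≤N}(x_j−x_k)² ∏_{j=1}^N w_H(x_j) dx₁⋯dx_N) / (∫_{ℝ^N} ∏_{1≤j<k≤N}(x_j−x_k)² ∏_{j=1}^N w_H(x_j) dx₁⋯dx_N) → F_∞(x₀) as N → ∞. -/

import Mathlib

noncomputable section

open Complex MeasureTheory Filter Set

/-- Rising Pochhammer symbol `(x)_n = x(x+1)⋯(x+n−1)`. -/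
def poch (x : ℂ) (n : ℕ) : ℂ := ∏ i ∈ Finset.range n, (x + i)

/-- Confluent hypergeometric series `₁F₁[r, q; z]`. -/
def oneF1 (r q z : ℂ) : ℂ := ∑' n : ℕ, poch r n / (poch q n * n.factorial) * z ^ n

/-- Terminating Gauss hypergeometric series `₂F₁[−m, b, c; z]`. -/
def twoF1neg (m : ℕ) (b c z : ℂ) : ℂ :=
  ∑ k ∈ Finset.range (m + 1),
    poch (-(m : ℂ)) k * poch b k / (poch c k * (k.factorial : ℂ)) * z ^ k

/-- The common prefactor `|2/x|^{Re s} e^{−i/x + π Im(s) Sgn(x)/2}`. -/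
def prefac (s : ℂ) (x : ℝ) : ℂ :=
  ((|2 / x| ^ s.re : ℝ) : ℂ) *
    Complex.exp (-Complex.I / (x : ℂ) + ((Real.pi * s.im * Real.sign x / 2 : ℝ) : ℂ))

/-- `P̃(x) = |2/x|^{Re s} e^{−i/x + π Im(s) Sgn(x)/2} ₁F₁[s, 2Re(s)+1; 2i/x]`. -/
def Ptilde (s : ℂ) (x : ℝ) : ℂ :=
  prefac s x * oneF1 s ((2 * s.re + 1 : ℝ) : ℂ) (2 * Complex.I / (x : ℂ))

/-- `Q(x) = (2/x)|2/x|^{Re s} e^{−i/x + π Im(s) Sgn(x)/2} ₁F₁[s+1, 2Re(s)+2; 2i/x]`. -/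
def Qfun (s : ℂ) (x : ℝ) : ℂ :=
  (2 / (x : ℂ)) * prefac s x * oneF1 (s + 1) ((2 * s.re + 2 : ℝ) : ℂ) (2 * Complex.I / (x : ℂ))

/-- The constant in front of the limiting kernel `K_∞`. -/
def cinf (s : ℂ) : ℂ :=
  (1 / (2 * (Real.pi : ℂ))) *
    (Complex.Gamma (s + 1) * Complex.Gamma ((starRingEnd ℂ) s + 1) /
      (Complex.Gamma ((2 * s.re + 1 : ℝ) : ℂ) * Complex.Gamma ((2 * s.re + 2 : ℝ) : ℂ)))

/-- The limiting kernel `K_∞`, as a complex number (it is in fact real). -/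
def KinfC (s : ℂ) (x y : ℝ) : ℂ :=
  if x = y then cinf s * (deriv (Ptilde s) x * Qfun s x - deriv (Qfun s) x * Ptilde s x)
  else cinf s * (Ptilde s x * Qfun s y - Qfun s x * Ptilde s y) / ((x : ℂ) - (y : ℂ))

/-- The limiting kernel `K_∞` (real-valued). -/
def Kinf (s : ℂ) (x y : ℝ) : ℝ := (KinfC s x y).re

/-- The generalized Cauchy weight `w_H` on `ℝ`. -/
def wH (s : ℂ) (N : ℕ) (x : ℝ) : ℝ :=
  (1 + x ^ 2) ^ (-s.re - (N : ℝ)) * Real.exp (2 * s.im * Complex.arg (1 + Complex.I * x))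

/-- The polynomial `p_{N−1}`. -/
def pPrev (s : ℂ) (N : ℕ) (x : ℝ) : ℂ :=
  ((x : ℂ) - Complex.I) ^ (N - 1) *
    twoF1neg (N - 1) (s + 1) ((2 * s.re + 2 : ℝ) : ℂ) (2 / (1 + Complex.I * (x : ℂ)))

/-- The polynomial `p̃_N`. -/
def pTil (s : ℂ) (N : ℕ) (x : ℝ) : ℂ :=
  ((x : ℂ) - Complex.I) ^ N *
    twoF1neg N s ((2 * s.re + 1 : ℝ) : ℂ) (2 / (1 + Complex.I * (x : ℂ)))

/-- The constant `C_{N,s}`. -/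
def CNs (s : ℂ) (N : ℕ) : ℂ :=
  (((2 : ℝ) ^ (2 * s.re) / Real.pi : ℝ) : ℂ) *
    (Complex.Gamma ((2 * s.re + N + 1 : ℝ) : ℂ) * Complex.Gamma (s + 1) *
        Complex.Gamma ((starRingEnd ℂ) s + 1) /
      (Complex.Gamma (N : ℂ) * Complex.Gamma ((2 * s.re + 1 : ℝ) : ℂ) *
        Complex.Gamma ((2 * s.re + 2 : ℝ) : ℂ)))

def phiN (s : ℂ) (N : ℕ) (x : ℝ) : ℂ := pTil s N x * (Real.sqrt (wH s N x) : ℂ)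

def psiN (s : ℂ) (N : ℕ) (x : ℝ) : ℂ := pPrev s N x * (Real.sqrt (wH s N x) : ℂ)

/-- The finite-`N` kernel `K_N` (complex form; extended to the diagonal by continuity,
i.e. by the Bernoulli–l'Hôpital expression). -/
def KNC (s : ℂ) (N : ℕ) (x y : ℝ) : ℂ :=
  if x = y then CNs s N * (deriv (phiN s N) x * psiN s N x - deriv (psiN s N) x * phiN s N x)
  else CNs s N * (phiN s N x * psiN s N y - psiN s N x * phiN s N y) / ((x : ℂ) - (y : ℂ))

/-- The finite-`N` kernel `K_N` (real-valued). -/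
def KN (s : ℂ) (N : ℕ) (x y : ℝ) : ℝ := (KNC s N x y).re

/-- The rescaled kernel `K_[N](x,y) = N · K_N(Nx, Ny)`. -/
def Kscaled (s : ℂ) (N : ℕ) (x y : ℝ) : ℝ := N * KN s N (N * x) (N * y)

/-- `P̃_N`. -/
def PtildeN (s : ℂ) (N : ℕ) (x : ℝ) : ℂ :=
  (((2 : ℝ) ^ s.re : ℝ) : ℂ) *
    (Real.sqrt (Real.Gamma (2 * s.re + N + 1) / (N * Real.Gamma N)) : ℂ) *
    pTil s N (N * x) * (Real.sqrt (wH s N (N * x)) : ℂ)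

/-- `Q_N`. -/
def QN (s : ℂ) (N : ℕ) (x : ℝ) : ℂ :=
  (((2 : ℝ) ^ (s.re + 1) : ℝ) : ℂ) *
    (Real.sqrt (N * Real.Gamma (2 * s.re + N + 1) / Real.Gamma N) : ℂ) *
    pPrev s N (N * x) * (Real.sqrt (wH s N (N * x)) : ℂ)

/-- `k`-point correlation function of a kernel. -/
def rhoK (K : ℝ → ℝ → ℝ) (k : ℕ) (x : Fin k → ℝ) : ℝ :=
  Matrix.det (Matrix.of fun i j => K (x i) (x j))

/-- The Fredholm determinant of a kernel restricted to `(t,∞)²`. -/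
def fredholmDet (K : ℝ → ℝ → ℝ) (t : ℝ) : ℝ :=
  1 + ∑' k : ℕ, ((-1 : ℝ) ^ (k + 1) / (k + 1).factorial) *
    ∫ x : Fin (k + 1) → ℝ in Set.univ.pi fun _ => Set.Ioi t, rhoK K (k + 1) x

/-- Mixed partial derivative `∂^{p+q}K/∂x^p∂y^q`. -/
def pderiv₂ (K : ℝ → ℝ → ℝ) (p q : ℕ) (x y : ℝ) : ℝ :=
  iteratedDeriv p (fun x' => iteratedDeriv q (fun y' => K x' y') y) x

/-- `F_{n,h,a}(x) = ₂F₁[−n, h, a; 2/(1+ix)]` (a terminating series). -/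
def Fnha (n : ℕ) (h : ℂ) (a : ℝ) (x : ℝ) : ℂ :=
  ∑' k : ℕ, poch (-(n : ℂ)) k * poch h k / (poch (a : ℂ) k * (k.factorial : ℂ)) *
    (2 / (1 + Complex.I * (x : ℂ))) ^ k

/-- `θ(τ) = τ (d/dτ) log F(τ⁻¹)`. -/
def thetaOf (F : ℝ → ℝ) (τ : ℝ) : ℝ := τ * deriv (fun u => Real.log (F u⁻¹)) τ

/-- Squared Vandermonde determinant `∏_{j<k} (x_j − x_k)²`. -/
def vandSq (N : ℕ) (x : Fin N → ℝ) : ℝ :=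
  ∏ p ∈ Finset.univ.filter fun p : Fin N × Fin N => p.1 < p.2, (x p.1 - x p.2) ^ 2

/-- `φ(x,y) = (f(x)g(y) − g(x)f(y))/(x−y)`, extended to the diagonal. -/
def phiFG (f g : ℝ → ℝ) (x y : ℝ) : ℝ :=
  if x = y then deriv f x * g x - deriv g x * f x else (f x * g y - g x * f y) / (x - y)

section Determinants

theorem sum_det_submatrix_eq_factorial_mul {n : Type*} [Fintype n] [DecidableEq n]
    (M : Matrix n n ℝ) (k : ℕ) :
    ∑ f : Fin k → n, (M.submatrix f f).det =
      (k.factorial : ℝ) * ∑ s ∈ Finset.univ.powersetCard k,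
        (M.submatrix (Subtype.val : s → n) (Subtype.val : s → n)).det := by
  classical
  have h1 : ∑ f : Fin k → n, (M.submatrix f f).det =
      ∑ f ∈ Finset.univ.filter (fun f : Fin k → n => Function.Injective f),
        (M.submatrix f f).det := by
    symm
    apply Finset.sum_filter_of_ne
    intro f _ hf
    by_contra hinj
    rw [Function.Injective] at hinj
    push Not at hinj
    obtain ⟨a, b, hab, hne⟩ := hinj
    exact hf (Matrix.det_zero_of_row_eq hne (by ext j; simp [hab]))
  have hmaps : ∀ f ∈ Finset.univ.filter (fun f : Fin k → n => Function.Injective f),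
      Finset.univ.image f ∈ (Finset.univ : Finset n).powersetCard k := by
    intro f hf
    simp only [Finset.mem_filter, Finset.mem_univ, true_and] at hf
    simp [Finset.mem_powersetCard, Finset.card_image_of_injective _ hf]
  rw [h1, ← Finset.sum_fiberwise_of_maps_to hmaps, Finset.mul_sum]
  refine Finset.sum_congr rfl fun s hs => ?_
  have hcard : s.card = k := (Finset.mem_powersetCard.mp hs).2
  have key : ∑ f ∈ (Finset.univ.filter (fun f : Fin k → n => Function.Injective f)).filter
        (fun f => Finset.univ.image f = s), (M.submatrix f f).det =
      ∑ _e : Fin k ≃ s, (M.submatrix (Subtype.val : s → n) (Subtype.val : s → n)).det := by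
    symm
    refine Finset.sum_bij (fun e _ => fun a => (e a : n)) ?_ ?_ ?_ ?_
    · intro e _
      simp only [Finset.mem_filter, Finset.mem_univ, true_and]
      refine ⟨Subtype.val_injective.comp e.injective, ?_⟩
      ext x
      simp only [Finset.mem_image, Finset.mem_univ, true_and]
      constructor
      · rintro ⟨a, rfl⟩; exact (e a).2
      · intro hx; exact ⟨e.symm ⟨x, hx⟩, by simp⟩
    · intro e _ e' _ h
      ext a
      exact congrFun h a
    · intro f hf
      simp only [Finset.mem_filter, Finset.mem_univ, true_and] at hf
      obtain ⟨hinj, him⟩ := hf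
      have hmem : ∀ a, f a ∈ s := fun a => him ▸ Finset.mem_image_of_mem f (Finset.mem_univ a)
      refine ⟨Equiv.ofBijective (fun a => (⟨f a, hmem a⟩ : s)) ⟨?_, ?_⟩, Finset.mem_univ _, ?_⟩
      · intro a b h; exact hinj (congrArg Subtype.val h)
      · rintro ⟨x, hx⟩
        rw [← him] at hx
        obtain ⟨a, _, rfl⟩ := Finset.mem_image.mp hx
        exact ⟨a, rfl⟩
      · rfl
    · intro e _
      rw [← Matrix.det_submatrix_equiv_self e
        (M.submatrix (Subtype.val : s → n) (Subtype.val : s → n))]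
      rfl
  rw [key, Finset.sum_const, nsmul_eq_mul, Finset.card_univ,
    Fintype.card_equiv (Fintype.equivOfCardEq (by simp [hcard]))]
  simp

theorem det_one_add_eq_sum_submatrix {n : Type*} [Fintype n] [DecidableEq n]
    (M : Matrix n n ℝ) :
    (1 + M).det = ∑ k ∈ Finset.range (Fintype.card n + 1),
      (1 / (k.factorial : ℝ)) * ∑ f : Fin k → n, (M.submatrix f f).det := by
  have h0 : ∀ k : ℕ, (1 / (k.factorial : ℝ)) * ∑ f : Fin k → n, (M.submatrix f f).det =
      (Matrix.det (1 + (Polynomial.X : Polynomial ℝ) • M.map Polynomial.C)).coeff k := by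
    intro k
    rw [Matrix.coeff_det_one_add_X_smul_eq_sum_minors, sum_det_submatrix_eq_factorial_mul]
    have : (k.factorial : ℝ) ≠ 0 := by positivity
    field_simp
  simp_rw [h0]
  have hdeg : (Matrix.det (1 + (Polynomial.X : Polynomial ℝ) • M.map Polynomial.C)).natDegree
      < Fintype.card n + 1 := by
    have := Polynomial.natDegree_det_X_add_C_le M (1 : Matrix n n ℝ)
    rw [add_comm (1 : Matrix n n (Polynomial ℝ))]
    simp only [Matrix.map_one _ (Polynomial.C_0) (Polynomial.C_1)] at this
    omega
  have := Polynomial.eval_eq_sum_range' hdeg 1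
  simp only [one_pow, mul_one] at this
  rw [← this, ← Polynomial.coe_evalRingHom, RingHom.map_det]
  congr 1
  ext i j
  by_cases h : i = j
  · simp [h]
  · simp [h]

theorem sum_det_submatrix_eq_zero {n : Type*} [Fintype n] [DecidableEq n]
    (M : Matrix n n ℝ) {k : ℕ} (hk : Fintype.card n < k) :
    ∑ f : Fin k → n, (M.submatrix f f).det = 0 := by
  rw [sum_det_submatrix_eq_factorial_mul, Finset.powersetCard_eq_empty.2 (by simpa using hk)]
  simp

end Determinants

section Andreief

variable {α : Type*} [MeasurableSpace α] (μ : Measure α) [SigmaFinite μ]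

theorem integrable_prod_mul_det {m : ℕ} (F G : Fin m → α → ℝ)
    (h : ∀ a b, Integrable (fun x => F b x * G a x) μ) :
    Integrable (fun x : Fin m → α =>
      (∏ b, F b (x b)) * (Matrix.of fun a b => G a (x b)).det) (Measure.pi fun _ => μ) := by
  simp only [Matrix.det_apply, Finset.mul_sum]
  refine integrable_finsetSum _ fun σ _ => ?_
  have := (Integrable.fintype_prod (f := fun b x => F b x * G (σ b) x)
    (μ := fun _ : Fin m => μ) (fun b => h (σ b) b)).smul ((Equiv.Perm.sign σ : ℤ) : ℝ)
  refine this.congr (Eventually.of_forall fun x => ?_)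
  simp only [Pi.smul_apply, Finset.prod_mul_distrib, Matrix.of_apply, smul_eq_mul, Units.smul_def,
    zsmul_eq_mul]
  ring

theorem integral_prod_mul_det {m : ℕ} (F G : Fin m → α → ℝ)
    (h : ∀ a b, Integrable (fun x => F b x * G a x) μ) :
    ∫ x : Fin m → α, (∏ b, F b (x b)) * (Matrix.of fun a b => G a (x b)).det
        ∂(Measure.pi fun _ => μ) =
      (Matrix.of fun a b => ∫ x, F b x * G a x ∂μ).det := by
  have hterm : ∀ σ : Equiv.Perm (Fin m), ∀ x : Fin m → α,
      (∏ b, F b (x b)) * (Equiv.Perm.sign σ • ∏ b, (Matrix.of fun a b => G a (x b)) (σ b) b) =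
      ((Equiv.Perm.sign σ : ℤ) : ℝ) * ∏ b, (F b (x b) * G (σ b) (x b)) := by
    intro σ x
    simp only [Finset.prod_mul_distrib, Matrix.of_apply, Units.smul_def, zsmul_eq_mul]
    ring
  simp only [Matrix.det_apply, Finset.mul_sum, hterm]
  rw [integral_finsetSum]
  · refine Finset.sum_congr rfl fun σ _ => ?_
    rw [integral_const_mul, integral_fintype_prod_eq_prod (fun b x => F b x * G (σ b) x)]
    simp [Units.smul_def]
  · intro σ _
    exact (Integrable.fintype_prod (f := fun b x => F b x * G (σ b) x)
      (μ := fun _ : Fin m => μ) (fun b => h (σ b) b)).const_mul _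

theorem andreief {m : ℕ} (F G : Fin m → α → ℝ)
    (h : ∀ a b, Integrable (fun x => F b x * G a x) μ) :
    ∫ x : Fin m → α, (Matrix.of fun a b => F a (x b)).det * (Matrix.of fun a b => G a (x b)).det
        ∂(Measure.pi fun _ => μ) =
      (m.factorial : ℝ) * (Matrix.of fun a b => ∫ x, F b x * G a x ∂μ).det := by
  have hF : ∀ x : Fin m → α, (Matrix.of fun a b => F a (x b)).det *
      (Matrix.of fun a b => G a (x b)).det = ∑ σ : Equiv.Perm (Fin m),
      ((Equiv.Perm.sign σ : ℤ) : ℝ) *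
        ((∏ b, F (σ b) (x b)) * (Matrix.of fun a b => G a (x b)).det) := by
    intro x
    rw [Matrix.det_apply (Matrix.of fun a b => F a (x b)), Finset.sum_mul]
    refine Finset.sum_congr rfl fun σ _ => ?_
    simp only [Matrix.of_apply, Units.smul_def, zsmul_eq_mul]
    ring
  simp only [hF]
  rw [integral_finsetSum]
  · have hσ : ∀ σ : Equiv.Perm (Fin m), ∫ x : Fin m → α, ((Equiv.Perm.sign σ : ℤ) : ℝ) *
        ((∏ b, F (σ b) (x b)) * (Matrix.of fun a b => G a (x b)).det)
          ∂(Measure.pi fun _ => μ) = (Matrix.of fun a b => ∫ x, F b x * G a x ∂μ).det := by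
      intro σ
      rw [integral_const_mul,
        integral_prod_mul_det μ (fun b => F (σ b)) G (fun a b => h a (σ b))]
      have := Matrix.det_permute' σ (Matrix.of fun a b => ∫ x, F b x * G a x ∂μ)
      have h2 : (Matrix.of fun a b => ∫ x, F (σ b) x * G a x ∂μ) =
        (Matrix.of fun a b => ∫ x, F b x * G a x ∂μ).submatrix id σ := rfl
      rw [h2, this, ← mul_assoc]
      have h3 : ((Equiv.Perm.sign σ : ℤ) : ℝ) * ((Equiv.Perm.sign σ : ℤ) : ℝ) = 1 := by
        rw [← Int.cast_mul, ← Units.val_mul, Int.units_mul_self]; simp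
      rw [h3, one_mul]
    simp [hσ, Finset.card_univ, Fintype.card_perm]
  · intro σ _
    exact (integrable_prod_mul_det μ (fun b => F (σ b)) G (fun a b => h a (σ b))).const_mul _

theorem integral_det_sum_mul {n m : ℕ} (F G : Fin n → α → ℝ)
    (h : ∀ a b, Integrable (fun x => F b x * G a x) μ) :
    ∫ x : Fin m → α, (Matrix.of fun a b => ∑ i, F i (x a) * G i (x b)).det
        ∂(Measure.pi fun _ => μ) =
      ∑ φ : Fin m → Fin n,
        ((Matrix.of fun a b => ∫ x, F b x * G a x ∂μ).submatrix φ φ).det := by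
  have hexp : ∀ x : Fin m → α, (Matrix.of fun a b => ∑ i, F i (x a) * G i (x b)).det =
      ∑ φ : Fin m → Fin n, (∏ a, F (φ a) (x a)) *
        (Matrix.of fun a b => G (φ a) (x b)).det := by
    intro x
    have h1 : (Matrix.of fun a b => ∑ i, F i (x a) * G i (x b)).det =
        Matrix.detRowAlternating (R := ℝ) (fun a => ∑ i, (F i (x a)) • fun b => G i (x b)) := by
      change Matrix.det _ = Matrix.det _
      congr 1
      ext a b
      simp
    rw [h1]
    have h2 := (Matrix.detRowAlternating (n := Fin m) (R := ℝ)).toMultilinearMap.map_sum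
      (fun (a : Fin m) (i : Fin n) => (F i (x a)) • fun b => G i (x b))
    simp only [AlternatingMap.coe_multilinearMap] at h2
    rw [h2]
    refine Finset.sum_congr rfl fun φ _ => ?_
    have h3 := (Matrix.detRowAlternating (n := Fin m) (R := ℝ)).toMultilinearMap.map_smul_univ
      (fun a => F (φ a) (x a)) (fun a => fun b => G (φ a) (x b))
    simp only [AlternatingMap.coe_multilinearMap] at h3
    rw [h3, smul_eq_mul]
    rfl
  simp only [hexp]
  rw [integral_finsetSum]
  · refine Finset.sum_congr rfl fun φ _ => ?_
    rw [integral_prod_mul_det μ (fun a => F (φ a)) (fun a => G (φ a)) (fun a b => h _ _)]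
    rfl
  · intro φ _
    exact integrable_prod_mul_det μ (fun a => F (φ a)) (fun a => G (φ a)) (fun a b => h _ _)

/-- Finite rank Fredholm expansion. -/
theorem det_one_sub_eq_fredholm {n : ℕ} (F G : Fin n → α → ℝ)
    (h : ∀ a b, Integrable (fun x => F b x * G a x) μ) :
    (1 - Matrix.of fun a b => ∫ x, F b x * G a x ∂μ).det =
      1 + ∑' k : ℕ, ((-1 : ℝ) ^ (k + 1) / (k + 1).factorial) *
        ∫ x : Fin (k + 1) → α, (Matrix.of fun a b => ∑ i, F i (x a) * G i (x b)).det
          ∂(Measure.pi fun _ => μ) := by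
  set M := Matrix.of fun a b => ∫ x, F b x * G a x ∂μ with hM
  rw [sub_eq_add_neg, det_one_add_eq_sum_submatrix, Finset.sum_range_succ']
  have hneg : ∀ k, ∑ φ : Fin k → Fin n, ((-M).submatrix φ φ).det =
      (-1) ^ k * ∑ φ : Fin k → Fin n, (M.submatrix φ φ).det := by
    intro k
    rw [Finset.mul_sum]
    refine Finset.sum_congr rfl fun φ _ => ?_
    have : (-M).submatrix φ φ = -(M.submatrix φ φ) := rfl
    rw [this, Matrix.det_neg, Fintype.card_fin]
  rw [add_comm, tsum_eq_sum (s := Finset.range n)]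
  · congr 1
    · simp
    · simp only [Fintype.card_fin]
      refine Finset.sum_congr rfl fun k _ => ?_
      rw [integral_det_sum_mul μ F G h, hneg]
      ring
  · intro k hk
    rw [integral_det_sum_mul μ F G h, sum_det_submatrix_eq_zero]
    · simp
    · simpa [Nat.lt_succ_iff] using hk

end Andreief

/-- Hadamard's inequality for positive semidefinite matrices. -/
theorem Matrix.PosSemidef.det_le_prod_diag {n : Type*} [Fintype n] [DecidableEq n]
    {M : Matrix n n ℝ} (hM : M.PosSemidef) : M.det ≤ ∏ i, M i i := by
  have hd : ∀ i, 0 ≤ M i i := fun i => hM.diag_nonneg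
  by_cases h0 : M.det = 0
  · rw [h0]; exact Finset.prod_nonneg fun i _ => hd i
  have hpd : M.PosDef := hM.posDef_iff_isUnit.2 ((Matrix.isUnit_iff_isUnit_det _).2 (isUnit_iff_ne_zero.2 h0))
  have hp : ∀ i, 0 < M i i := fun i => hpd.diag_pos
  set D : Matrix n n ℝ := Matrix.diagonal fun i => (Real.sqrt (M i i))⁻¹ with hD
  have hN : (D * M * D.conjTranspose).PosSemidef := hM.mul_mul_conjTranspose_same D
  set N := D * M * D.conjTranspose with hNdef
  have hdiag : ∀ i, N i i = 1 := by
    intro i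
    have hs : Real.sqrt (M i i) ≠ 0 := (Real.sqrt_pos.2 (hp i)).ne'
    simp only [hNdef, hD, Matrix.diagonal_conjTranspose, Matrix.mul_diagonal, Matrix.diagonal_mul,
      star_trivial]
    field_simp
    simp [Real.sq_sqrt (hd i)]
  have hdetN : N.det ≤ 1 := by
    have h1 := hN.isHermitian.det_eq_prod_eigenvalues
    have h2 := hN.isHermitian.trace_eq_sum_eigenvalues
    simp only [RCLike.ofReal_real_eq_id, id] at h1 h2
    rw [h1]
    calc ∏ i, hN.isHermitian.eigenvalues i
        ≤ ∏ i, Real.exp (hN.isHermitian.eigenvalues i - 1) := by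
          refine Finset.prod_le_prod (fun i _ => hN.eigenvalues_nonneg i) fun i _ => ?_
          have := Real.add_one_le_exp (hN.isHermitian.eigenvalues i - 1)
          linarith
      _ = 1 := by
          rw [← Real.exp_sum, Finset.sum_sub_distrib, ← h2]
          simp [Matrix.trace, hdiag]
  have hdet : N.det = M.det / ∏ i, M i i := by
    rw [hNdef, Matrix.det_mul, Matrix.det_mul, Matrix.det_conjTranspose, hD, Matrix.det_diagonal,
      star_trivial, Finset.prod_inv_distrib]
    have : (∏ i, M i i) = (∏ i, Real.sqrt (M i i)) * ∏ i, Real.sqrt (M i i) := by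
      rw [← Finset.prod_mul_distrib]
      exact Finset.prod_congr rfl fun i _ => (Real.mul_self_sqrt (hd i)).symm
    rw [this]
    field_simp
  rw [hdet, div_le_one (Finset.prod_pos fun i _ => hp i)] at hdetN
  exact hdetN

section GammaIntegral

theorem norm_cpow_mul_exp {a z : ℂ} {t : ℝ} (ht : 0 < t) :
    ‖(t : ℂ) ^ (a - 1) * Complex.exp (-(z * t))‖ = t ^ (a.re - 1) * Real.exp (-z.re * t) := by
  rw [norm_mul, Complex.norm_cpow_eq_rpow_re_of_pos ht, Complex.norm_exp]
  simp

theorem continuousOn_cpow_mul_exp (a z : ℂ) :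
    ContinuousOn (fun t : ℝ => (t : ℂ) ^ (a - 1) * Complex.exp (-(z * t))) (Ioi 0) := by
  intro t ht
  have h1 : ContinuousAt (fun t : ℝ => (t : ℂ) ^ (a - 1)) t :=
    (continuousAt_cpow_const (Or.inl (by simpa using ht))).comp
      Complex.continuous_ofReal.continuousAt
  exact (h1.mul (by fun_prop)).continuousWithinAt

theorem integrableOn_rpow_mul_exp {a r : ℝ} (ha : 0 < a) (hr : 0 < r) :
    IntegrableOn (fun t : ℝ => t ^ (a - 1) * Real.exp (-r * t)) (Ioi 0) := by
  have := integrableOn_rpow_mul_exp_neg_mul_rpow (p := 1) (s := a - 1) (b := r)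
    (by linarith) one_pos hr
  simpa using this

theorem integrableOn_cpow_mul_exp {a z : ℂ} (ha : 0 < a.re) (hz : 0 < z.re) :
    IntegrableOn (fun t : ℝ => (t : ℂ) ^ (a - 1) * Complex.exp (-(z * t))) (Ioi 0) := by
  refine (integrableOn_rpow_mul_exp ha hz).mono'
    ((continuousOn_cpow_mul_exp a z).aestronglyMeasurable measurableSet_Ioi) ?_
  filter_upwards [ae_restrict_mem measurableSet_Ioi] with t ht
  exact (norm_cpow_mul_exp ht).le

theorem differentiableAt_integral_cpow_mul_exp {a z : ℂ} (ha : 0 < a.re) (hz : 0 < z.re) :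
    DifferentiableAt ℂ
      (fun z : ℂ => ∫ t in Ioi (0 : ℝ), (t : ℂ) ^ (a - 1) * Complex.exp (-(z * t))) z := by
  have hs : {w : ℂ | z.re / 2 < w.re} ∈ nhds z :=
    (isOpen_lt continuous_const Complex.continuous_re).mem_nhds (by simp; linarith)
  refine (hasDerivAt_integral_of_dominated_loc_of_deriv_le (𝕜 := ℂ)
    (μ := volume.restrict (Ioi (0 : ℝ)))
    (F := fun w t => (t : ℂ) ^ (a - 1) * Complex.exp (-(w * t)))
    (F' := fun w t => (t : ℂ) ^ (a - 1) * (Complex.exp (-(w * t)) * (-t)))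
    (bound := fun t => t ^ ((a.re + 1) - 1) * Real.exp (-(z.re / 2) * t)) hs ?_
    (integrableOn_cpow_mul_exp ha hz) ?_ ?_ ?_ ?_).2.differentiableAt
  · exact Eventually.of_forall fun w =>
      (continuousOn_cpow_mul_exp a w).aestronglyMeasurable measurableSet_Ioi
  · have : ContinuousOn (fun t : ℝ => (t : ℂ) ^ (a - 1) * (Complex.exp (-(z * t)) * (-t)))
        (Ioi 0) := by
      simp_rw [← mul_assoc]
      exact (continuousOn_cpow_mul_exp a z).mul (by fun_prop)
    exact this.aestronglyMeasurable measurableSet_Ioi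
  · filter_upwards [ae_restrict_mem measurableSet_Ioi] with t ht w hw
    have ht' : (0 : ℝ) < t := ht
    rw [← mul_assoc, norm_mul, norm_cpow_mul_exp ht', norm_neg, Complex.norm_real,
      Real.norm_of_nonneg ht'.le]
    have h1 : t ^ ((a.re + 1) - 1) = t ^ (a.re - 1) * t := by
      rw [show a.re + 1 - 1 = (a.re - 1) + 1 by ring, Real.rpow_add_one ht'.ne']
    rw [h1]
    have h2 : Real.exp (-w.re * t) ≤ Real.exp (-(z.re / 2) * t) := by
      apply Real.exp_le_exp.2
      have : z.re / 2 < w.re := hw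
      nlinarith
    have h3 : 0 ≤ t ^ (a.re - 1) := by positivity
    calc t ^ (a.re - 1) * Real.exp (-w.re * t) * t
        = (t ^ (a.re - 1) * t) * Real.exp (-w.re * t) := by ring
      _ ≤ _ := by gcongr
  · exact integrableOn_rpow_mul_exp (by linarith) (by linarith)
  · refine Eventually.of_forall fun t w _ => ?_
    have h1 : HasDerivAt (fun w : ℂ => -(w * t)) (-(1 * (t : ℂ))) w :=
      ((hasDerivAt_id w).mul_const (t : ℂ)).neg
    have := (h1.cexp.const_mul ((t : ℂ) ^ (a - 1)))
    simpa using this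

/-- `∫₀^∞ t^{a-1} e^{-zt} dt = Γ(a) z^{-a}` for complex rates `z` in the right half plane. -/
theorem integral_cpow_mul_exp_complex {a z : ℂ} (ha : 0 < a.re) (hz : 0 < z.re) :
    ∫ t in Ioi (0 : ℝ), (t : ℂ) ^ (a - 1) * Complex.exp (-(z * t)) =
      z ^ (-a) * Complex.Gamma a := by
  have hopen : IsOpen {w : ℂ | 0 < w.re} := isOpen_lt continuous_const Complex.continuous_re
  have hpre : IsPreconnected {w : ℂ | 0 < w.re} := (convex_halfSpace_re_gt 0).isPreconnected
  have hf : AnalyticOnNhd ℂ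
      (fun z : ℂ => ∫ t in Ioi (0 : ℝ), (t : ℂ) ^ (a - 1) * Complex.exp (-(z * t)))
      {w : ℂ | 0 < w.re} :=
    DifferentiableOn.analyticOnNhd
      (fun w hw => (differentiableAt_integral_cpow_mul_exp ha hw).differentiableWithinAt) hopen
  have hg : AnalyticOnNhd ℂ (fun z : ℂ => z ^ (-a) * Complex.Gamma a) {w : ℂ | 0 < w.re} := by
    refine DifferentiableOn.analyticOnNhd (fun w hw => ?_) hopen
    have : DifferentiableAt ℂ (fun z : ℂ => z ^ (-a)) w :=
      differentiableAt_id.cpow_const (Or.inl hw)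
    exact (this.mul_const _).differentiableWithinAt
  refine hf.eqOn_of_preconnected_of_frequently_eq hg hpre (z₀ := 1) (by simp) ?_ hz
  have htend : Tendsto (fun r : ℝ => (r : ℂ)) (nhdsWithin 1 {1}ᶜ) (nhdsWithin 1 {1}ᶜ) := by
    refine tendsto_nhdsWithin_iff.2 ⟨?_, ?_⟩
    · have : Tendsto (fun r : ℝ => (r : ℂ)) (nhds 1) (nhds ((1 : ℝ) : ℂ)) :=
        Complex.continuous_ofReal.tendsto 1
      rw [Complex.ofReal_one] at this
      exact this.mono_left nhdsWithin_le_nhds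
    · filter_upwards [self_mem_nhdsWithin] with r hr
      simpa using hr
  refine htend.frequently (Eventually.frequently ?_)
  have : ∀ᶠ r : ℝ in nhdsWithin 1 {1}ᶜ, 0 < r :=
    nhdsWithin_le_nhds (lt_mem_nhds one_pos)
  filter_upwards [this] with r hr
  rw [Complex.integral_cpow_mul_exp_neg_mul_Ioi ha hr]
  congr 1
  rw [one_div, Complex.inv_cpow _ _ (by rw [Complex.arg_ofReal_of_nonneg hr.le]; exact Real.pi_pos.ne),
    Complex.cpow_neg]

end GammaIntegral

section CauchyIntegral

open scoped FourierTransform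

/-- The Cauchy-type function `(1+ix)^{-a}(1-ix)^{-b}`. -/
def cauchyFun (a b : ℂ) (x : ℝ) : ℂ := (1 + I * x) ^ (-a) * (1 - I * x) ^ (-b)

theorem one_add_I_mul_mem_slitPlane (x : ℝ) : (1 + I * x : ℂ) ∈ slitPlane :=
  Or.inl (by simp)

theorem one_sub_I_mul_mem_slitPlane (x : ℝ) : (1 - I * x : ℂ) ∈ slitPlane :=
  Or.inl (by simp)

theorem one_add_I_mul_ne_zero (x : ℝ) : (1 + I * x : ℂ) ≠ 0 :=
  slitPlane_ne_zero (one_add_I_mul_mem_slitPlane x)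

theorem one_sub_I_mul_ne_zero (x : ℝ) : (1 - I * x : ℂ) ≠ 0 :=
  slitPlane_ne_zero (one_sub_I_mul_mem_slitPlane x)

theorem norm_one_add_I_mul (x : ℝ) : ‖(1 + I * x : ℂ)‖ = (1 + x ^ 2) ^ (1 / 2 : ℝ) := by
  rw [← Real.sqrt_eq_rpow, Complex.norm_def, Complex.normSq_apply]
  congr 1
  simp
  ring

theorem norm_one_sub_I_mul (x : ℝ) : ‖(1 - I * x : ℂ)‖ = (1 + x ^ 2) ^ (1 / 2 : ℝ) := by
  have := norm_one_add_I_mul (-x)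
  simpa [sub_eq_add_neg] using this

theorem norm_cpow_neg_le {z : ℂ} (hz : z ≠ 0) (a : ℂ) :
    ‖z ^ (-a)‖ ≤ ‖z‖ ^ (-a.re) * Real.exp (Real.pi * |a.im|) := by
  rw [norm_cpow_of_ne_zero hz, div_eq_mul_inv, ← Real.exp_neg]
  simp only [neg_re, neg_im]
  gcongr
  have h1 := abs_arg_le_pi z
  calc -(z.arg * -a.im) = z.arg * a.im := by ring
    _ ≤ |z.arg * a.im| := le_abs_self _
    _ = |z.arg| * |a.im| := abs_mul _ _
    _ ≤ _ := by gcongr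

theorem norm_cauchyFun_le (a b : ℂ) (x : ℝ) :
    ‖cauchyFun a b x‖ ≤ Real.exp (Real.pi * |a.im|) * Real.exp (Real.pi * |b.im|) *
      (1 + x ^ 2) ^ (-(a + b).re / 2) := by
  have h0 : 0 < 1 + x ^ 2 := by positivity
  have h1 := norm_cpow_neg_le (one_add_I_mul_ne_zero x) a
  have h2 := norm_cpow_neg_le (one_sub_I_mul_ne_zero x) b
  rw [norm_one_add_I_mul, ← Real.rpow_mul h0.le] at h1
  rw [norm_one_sub_I_mul, ← Real.rpow_mul h0.le] at h2
  have h3 : (1 + x ^ 2) ^ (-(a + b).re / 2) =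
      (1 + x ^ 2) ^ (1 / 2 * -a.re) * (1 + x ^ 2) ^ (1 / 2 * -b.re) := by
    rw [← Real.rpow_add h0]
    congr 1
    simp
    ring
  rw [cauchyFun, norm_mul, h3]
  calc _ ≤ _ := mul_le_mul h1 h2 (norm_nonneg _) (by positivity)
    _ = _ := by ring

theorem continuous_cauchyFun (a b : ℂ) : Continuous (cauchyFun a b) := by
  unfold cauchyFun
  refine Continuous.mul ?_ ?_
  · exact (by fun_prop : Continuous fun x : ℝ => (1 + I * x : ℂ)).cpow continuous_const
      one_add_I_mul_mem_slitPlane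
  · exact (by fun_prop : Continuous fun x : ℝ => (1 - I * x : ℂ)).cpow continuous_const
      one_sub_I_mul_mem_slitPlane

theorem integrable_cauchyFun {a b : ℂ} (h : 1 < (a + b).re) : Integrable (cauchyFun a b) := by
  have h1 := integrable_rpow_neg_one_add_norm_sq (E := ℝ) (μ := volume) (r := (a + b).re)
    (by simpa using h)
  refine (h1.const_mul (Real.exp (Real.pi * |a.im|) * Real.exp (Real.pi * |b.im|))).mono'
    (continuous_cauchyFun a b).aestronglyMeasurable (Eventually.of_forall fun x => ?_)
  have := norm_cauchyFun_le a b x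
  simpa using this

theorem hasDerivAt_one_add_cpow (a : ℂ) (x : ℝ) :
    HasDerivAt (fun x : ℝ => (1 + I * x : ℂ) ^ (-a)) (-a * (1 + I * x) ^ (-a - 1) * I) x := by
  have h1 : HasDerivAt (fun z : ℂ => 1 + I * z) I (x : ℂ) := by
    simpa using ((hasDerivAt_id (x : ℂ)).const_mul I).const_add 1
  exact (h1.cpow_const (one_add_I_mul_mem_slitPlane x)).comp_ofReal

theorem hasDerivAt_one_sub_cpow (a : ℂ) (x : ℝ) :
    HasDerivAt (fun x : ℝ => (1 - I * x : ℂ) ^ (-a)) (-a * (1 - I * x) ^ (-a - 1) * -I) x := by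
  have h1 : HasDerivAt (fun z : ℂ => 1 - I * z) (-I) (x : ℂ) := by
    simpa using ((hasDerivAt_id (x : ℂ)).const_mul I).const_sub 1
  exact (h1.cpow_const (one_sub_I_mul_mem_slitPlane x)).comp_ofReal

theorem tendsto_cauchyFun_zero {a b : ℂ} (h : 0 < (a + b).re) {l : Filter ℝ}
    (hl : Tendsto (fun x : ℝ => 1 + x ^ 2) l atTop) :
    Tendsto (cauchyFun a b) l (nhds 0) := by
  refine squeeze_zero_norm (norm_cauchyFun_le a b) ?_
  have h1 := (tendsto_rpow_neg_atTop (y := (a + b).re / 2) (by linarith)).comp hl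
  have h2 := h1.const_mul (Real.exp (Real.pi * |a.im|) * Real.exp (Real.pi * |b.im|))
  rw [mul_zero] at h2
  refine h2.congr fun x => ?_
  simp only [Function.comp_apply]
  congr 2
  ring

theorem integral_cauchyFun_succ {a b : ℂ} (h : 1 < (a + b).re) :
    (a + b - 1) * ∫ x, cauchyFun a b x = 2 * a * ∫ x, cauchyFun (a + 1) b x := by
  have hder : ∀ x : ℝ, HasDerivAt (cauchyFun a (b - 1))
      (I * ((a + b - 1) * cauchyFun a b x - 2 * a * cauchyFun (a + 1) b x)) x := by
    intro x
    have h1 := (hasDerivAt_one_add_cpow a x).mul (hasDerivAt_one_sub_cpow (b - 1) x)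
    refine h1.congr_deriv ?_
    have e1 : (1 - I * x : ℂ) ^ (-(b - 1)) = (1 - I * x) ^ (-b) * (1 - I * x) := by
      rw [show -(b - 1) = -b + 1 by ring, cpow_add _ _ (one_sub_I_mul_ne_zero x), cpow_one]
    have e2 : (1 - I * x : ℂ) ^ (-(b - 1) - 1) = (1 - I * x) ^ (-b) := by
      congr 1; ring
    have e3 : (1 + I * x : ℂ) ^ (-a) = (1 + I * x) ^ (-(a + 1)) * (1 + I * x) := by
      rw [show -a = -(a + 1) + 1 by ring, cpow_add _ _ (one_add_I_mul_ne_zero x), cpow_one]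
    have e4 : (1 + I * x : ℂ) ^ (-a - 1) = (1 + I * x) ^ (-(a + 1)) := by
      congr 1; ring
    simp only [cauchyFun]
    rw [e1, e2, e4, e3]
    ring
  have hi1 := integrable_cauchyFun h
  have hi2 : Integrable (cauchyFun (a + 1) b) := integrable_cauchyFun (by
    simp only [add_re, one_re] at h ⊢; linarith)
  have hint : Integrable fun x : ℝ =>
      I * ((a + b - 1) * cauchyFun a b x - 2 * a * cauchyFun (a + 1) b x) :=
    ((hi1.const_mul _).sub (hi2.const_mul _)).const_mul _
  have hre : 0 < (a + (b - 1)).re := by simp at h ⊢; linarith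
  have hsq : Tendsto (fun x : ℝ => x ^ 2) atBot atTop := by
    refine ((tendsto_pow_atTop two_ne_zero).comp (tendsto_abs_atBot_atTop (G := ℝ))).congr
      fun x => ?_
    simp
  have hz := integral_of_hasDerivAt_of_tendsto hder hint
    (tendsto_cauchyFun_zero hre (tendsto_atTop_add_const_left _ 1 hsq))
    (tendsto_cauchyFun_zero hre
      (tendsto_atTop_add_const_left _ 1 (tendsto_pow_atTop (two_ne_zero))))
  rw [integral_const_mul, integral_sub (hi1.const_mul _) (hi2.const_mul _), integral_const_mul,
    integral_const_mul, sub_zero] at hz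
  have := (mul_eq_zero.1 hz).resolve_left I_ne_zero
  exact sub_eq_zero.1 this

/-- The Gamma density `t^{a-1}e^{-t}` on the half line. -/
def gammaFun (a : ℂ) : ℝ → ℂ :=
  (Ioi (0 : ℝ)).indicator fun t => (t : ℂ) ^ (a - 1) * Complex.exp (-(1 * t))

theorem integrable_gammaFun {a : ℂ} (ha : 0 < a.re) : Integrable (gammaFun a) :=
  (integrable_indicator_iff measurableSet_Ioi).2 (integrableOn_cpow_mul_exp ha (by simp))

theorem fourier_gammaFun {a : ℂ} (ha : 0 < a.re) (w : ℝ) :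
    𝓕 (gammaFun a) w = (1 + I * (2 * Real.pi * w : ℝ)) ^ (-a) * Complex.Gamma a := by
  rw [Real.fourier_eq', ← integral_cpow_mul_exp_complex ha
    (z := 1 + I * (2 * Real.pi * w : ℝ)) (by simp), ← integral_indicator measurableSet_Ioi]
  congr 1
  ext t
  by_cases ht : t ∈ Ioi (0 : ℝ)
  · simp only [gammaFun, indicator_of_mem ht, smul_eq_mul]
    rw [mul_left_comm, ← Complex.exp_add]
    congr 2
    simp
    ring
  · simp [gammaFun, indicator_of_notMem ht]

theorem continuous_gammaFun {a : ℂ} (ha : 1 < a.re) : Continuous (gammaFun a) := by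
  have hc : Continuous fun t : ℝ => ((max t 0 : ℝ) : ℂ) ^ (a - 1) * Complex.exp (-(1 * t)) := by
    refine Continuous.mul ?_ (by fun_prop)
    refine (Complex.continuous_ofReal_cpow_const (y := a - 1) ?_).comp (by fun_prop : Continuous fun t : ℝ => max t 0)
    simp; linarith
  convert hc using 1
  ext t
  by_cases ht : t ∈ Ioi (0 : ℝ)
  · have : max t 0 = t := max_eq_left (le_of_lt ht)
    simp only [gammaFun, indicator_of_mem ht, this]
  · have h1 : max t 0 = 0 := max_eq_right (by simpa using ht)
    have h2 : a - 1 ≠ 0 := by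
      intro h; have := congrArg Complex.re h; simp at this; linarith
    simp only [gammaFun, indicator_of_notMem ht, h1, ofReal_zero, Complex.zero_cpow h2, zero_mul]

theorem integral_cauchyFun_of_one_lt {a b : ℂ} (ha : 1 < a.re) (hb : 0 < b.re) :
    ∫ x, cauchyFun a b x = 2 * Real.pi * 2 ^ (1 - a - b) * Complex.Gamma (a + b - 1) *
      (1 / Complex.Gamma a) * (1 / Complex.Gamma b) := by
  have ha0 : 0 < a.re := by linarith
  have hGa : Complex.Gamma a ≠ 0 := Complex.Gamma_ne_zero_of_re_pos ha0
  have hGb : Complex.Gamma b ≠ 0 := Complex.Gamma_ne_zero_of_re_pos hb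
  have hpi : (2 * Real.pi) ≠ 0 := by positivity
  have hFint : Integrable (𝓕 (gammaFun a)) := by
    have h1 : Integrable (cauchyFun a 0) := integrable_cauchyFun (by simpa using ha)
    have h2 := (h1.comp_mul_left' hpi).mul_const (Complex.Gamma a)
    refine h2.congr (Eventually.of_forall fun w => ?_)
    simp only [fourier_gammaFun ha0, cauchyFun, neg_zero, cpow_zero, mul_one]
  have hinv := (continuous_gammaFun ha).fourierInv_fourier_eq (integrable_gammaFun ha0) hFint
  have hflip := VectorFourier.integral_fourierIntegral_smul_eq_flip (L := innerₗ ℝ)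
    (μ := volume) (ν := volume) Real.continuous_fourierChar continuous_inner
    (integrable_gammaFun hb) (hFint.comp_neg)
  have e1 : ∀ w : ℝ, VectorFourier.fourierIntegral Real.fourierChar volume (innerₗ ℝ)
      (gammaFun b) w = 𝓕 (gammaFun b) w := fun w => rfl
  have e2 : ∀ w : ℝ, VectorFourier.fourierIntegral Real.fourierChar volume (innerₗ ℝ).flip
      (fun t => 𝓕 (gammaFun a) (-t)) w = gammaFun a w := by
    intro w
    have : 𝓕⁻ (𝓕 (gammaFun a)) w = 𝓕 (fun t => 𝓕 (gammaFun a) (-t)) w := by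
      rw [Real.fourierInv_eq_fourier_comp_neg]
    rw [hinv] at this
    rw [flip_innerₗ, this]
    rfl
  simp only [e1, e2, smul_eq_mul] at hflip
  have hL : ∫ w, 𝓕 (gammaFun b) w * 𝓕 (gammaFun a) (-w) =
      Complex.Gamma a * Complex.Gamma b * ((1 / (2 * Real.pi) : ℝ) * ∫ x, cauchyFun a b x) := by
    have h1 := Measure.integral_comp_mul_left (cauchyFun a b) (2 * Real.pi)
    rw [abs_of_pos (by positivity), ← one_div] at h1
    rw [← Complex.real_smul, ← h1, ← integral_const_mul, ← integral_neg_eq_self]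
    congr 1
    ext w
    rw [neg_neg, fourier_gammaFun ha0, fourier_gammaFun hb, cauchyFun]
    have : (1 + I * ((2 * Real.pi * -w : ℝ) : ℂ)) = 1 - I * ((2 * Real.pi * w : ℝ) : ℂ) := by
      push_cast; ring
    rw [this]
    ring
  have hR : ∫ t, gammaFun b t * gammaFun a t =
      2 ^ (1 - a - b) * Complex.Gamma (a + b - 1) := by
    have h1 := integral_cpow_mul_exp_complex (a := a + b - 1) (z := 2)
      (by simp; linarith) (by simp)
    rw [show -(a + b - 1) = 1 - a - b by ring] at h1
    rw [← h1, ← integral_indicator measurableSet_Ioi]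
    congr 1
    ext t
    by_cases ht : t ∈ Ioi (0 : ℝ)
    · simp only [gammaFun, indicator_of_mem ht]
      have ht' : (t : ℂ) ≠ 0 := by exact_mod_cast (ne_of_gt ht)
      rw [mul_mul_mul_comm, ← Complex.exp_add, ← Complex.cpow_add _ _ ht']
      congr 2 <;> ring
    · simp [gammaFun, indicator_of_notMem ht]
  rw [hL, hR] at hflip
  have hpiC : (Real.pi : ℂ) ≠ 0 := by exact_mod_cast Real.pi_ne_zero
  push_cast at hflip
  field_simp at hflip ⊢
  linear_combination hflip

/-- Cauchy's beta integral. -/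
theorem integral_cauchyFun {a b : ℂ} (hb : 0 < b.re) (hab : 1 < (a + b).re) :
    ∫ x, cauchyFun a b x = 2 * Real.pi * 2 ^ (1 - a - b) * Complex.Gamma (a + b - 1) *
      (1 / Complex.Gamma a) * (1 / Complex.Gamma b) := by
  obtain ⟨n, hn⟩ := exists_nat_gt (1 - a.re)
  induction n generalizing a with
  | zero => exact integral_cauchyFun_of_one_lt (by simpa using hn) hb
  | succ n ih =>
    have hab' : 1 < (a + 1 + b).re := by simp at hab ⊢; linarith
    have h1 := ih hab' (by push_cast at hn; simp; linarith)
    have h2 := integral_cauchyFun_succ hab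
    rw [h1] at h2
    have hne : a + b - 1 ≠ 0 := by
      intro h; have := congrArg Complex.re h; simp at this hab; linarith
    have h3 : Complex.Gamma (a + 1 + b - 1) = (a + b - 1) * Complex.Gamma (a + b - 1) := by
      rw [← Complex.Gamma_add_one _ hne]; congr 1; ring
    have h4 : (2 : ℂ) ^ (1 - (a + 1) - b) = 2 ^ (1 - a - b) / 2 := by
      rw [show 1 - (a + 1) - b = (1 - a - b) - 1 by ring, cpow_sub _ _ two_ne_zero, cpow_one]
    have h5 := Complex.one_div_Gamma_eq_self_mul_one_div_Gamma_add_one a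
    simp only [one_div] at h2 ⊢ h5
    rw [h5]
    rw [h3, h4] at h2
    apply mul_left_cancel₀ hne
    rw [h2]
    ring

end CauchyIntegral

theorem ofReal_wH (s : ℂ) (N : ℕ) (x : ℝ) :
    (wH s N x : ℂ) = cauchyFun (s + N) ((starRingEnd ℂ) s + N) x := by
  have h0 : (0 : ℝ) < 1 + x ^ 2 := by positivity
  have hz := one_add_I_mul_ne_zero x
  have hconj : (1 - I * x : ℂ) = (starRingEnd ℂ) (1 + I * x) := by simp [sub_eq_add_neg]
  have harg : (1 + I * x : ℂ).arg ≠ Real.pi := by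
    intro h
    have := mem_slitPlane_iff_arg.1 (one_add_I_mul_mem_slitPlane x)
    exact this.1 h
  have h1 : (1 - I * x : ℂ) ^ (-((starRingEnd ℂ) s + N)) =
      (starRingEnd ℂ) ((1 + I * x) ^ (-(s + N))) := by
    rw [hconj, conj_cpow _ _ harg]
    simp
  rw [cauchyFun, h1, mul_conj, normSq_eq_norm_sq, norm_cpow_of_ne_zero hz, norm_one_add_I_mul, wH]
  congr 1
  rw [div_pow, div_eq_mul_inv, ← Real.rpow_mul h0.le, ← Real.rpow_mul_natCast h0.le,
    ← Real.exp_nat_mul, ← Real.exp_neg]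
  congr 2
  · simp; ring
  · simp; ring

theorem wH_pos (s : ℂ) (N : ℕ) (x : ℝ) : 0 < wH s N x := by
  unfold wH; positivity

theorem pow_mul_cauchyFun (a b : ℂ) (j l : ℕ) (x : ℝ) :
    (1 + I * x : ℂ) ^ j * (1 - I * x) ^ l * cauchyFun a b x = cauchyFun (a - j) (b - l) x := by
  have h1 : (1 + I * x : ℂ) ^ (-(a - j)) = (1 + I * x) ^ j * (1 + I * x) ^ (-a) := by
    rw [show -(a - j) = (j : ℂ) + -a by ring, cpow_add _ _ (one_add_I_mul_ne_zero x), cpow_natCast]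
  have h2 : (1 - I * x : ℂ) ^ (-(b - l)) = (1 - I * x) ^ l * (1 - I * x) ^ (-b) := by
    rw [show -(b - l) = (l : ℂ) + -b by ring, cpow_add _ _ (one_sub_I_mul_ne_zero x), cpow_natCast]
  rw [cauchyFun, cauchyFun, h1, h2]
  ring

theorem poch_zero (x : ℂ) : poch x 0 = 1 := by simp [poch]

theorem poch_succ (x : ℂ) (n : ℕ) : poch x (n + 1) = poch x n * (x + n) := by
  simp [poch, Finset.prod_range_succ]

theorem poch_succ' (x : ℂ) (n : ℕ) : poch x (n + 1) = x * poch (x + 1) n := by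
  simp only [poch, Finset.prod_range_succ']
  rw [mul_comm]
  push_cast
  congr 1
  · simp
  · exact Finset.prod_congr rfl fun i _ => by ring

theorem poch_ne_zero {x : ℂ} (hx : 0 < x.re) (n : ℕ) : poch x n ≠ 0 := by
  refine Finset.prod_ne_zero_iff.2 fun i _ h => ?_
  have := congrArg re h
  simp at this
  have hi : (0 : ℝ) ≤ i := by positivity
  linarith

theorem poch_neg_eq_zero {n k : ℕ} (h : n < k) : poch (-(n : ℂ)) k = 0 :=
  Finset.prod_eq_zero (Finset.mem_range.2 h) (by simp)

/-- `(Γ s)⁻¹ = (s)_k (Γ (s + k))⁻¹`, valid also at the poles. -/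
theorem Gamma_inv_eq_poch_mul (s : ℂ) (k : ℕ) :
    (Gamma s)⁻¹ = poch s k * (Gamma (s + k))⁻¹ := by
  induction k with
  | zero => simp [poch_zero]
  | succ k ih =>
    rw [ih, poch_succ, Complex.one_div_Gamma_eq_self_mul_one_div_Gamma_add_one (s + k)]
    push_cast
    ring_nf

theorem Gamma_add_nat_eq_poch_mul {s : ℂ} (hs : 0 < s.re) (k : ℕ) :
    Gamma (s + k) = poch s k * Gamma s := by
  have h1 := Gamma_inv_eq_poch_mul s k
  have h2 := Gamma_ne_zero_of_re_pos hs
  have h3 : Gamma (s + k) ≠ 0 := Gamma_ne_zero_of_re_pos (by simp; positivity)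
  field_simp at h1
  linear_combination h1

theorem poch_neg_nat_eq (n k : ℕ) :
    poch (-(n : ℂ)) k = (-1) ^ k * (n.descFactorial k : ℂ) := by
  induction k with
  | zero => simp [poch_zero]
  | succ k ih =>
    rw [poch_succ, ih, Nat.descFactorial_succ]
    rcases le_or_gt k n with h | h
    · push_cast [Nat.cast_sub h]; ring
    · simp [Nat.descFactorial_of_lt h]

/-- Chu–Vandermonde, in polynomial form. -/
theorem sum_choose_mul_poch (n : ℕ) (b c : ℂ) :
    ∑ k ∈ Finset.range (n + 1), (-1) ^ k * (n.choose k : ℂ) * poch b k * poch (c + k) (n - k) =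
      poch (c - b) n := by
  induction n generalizing b c with
  | zero => simp [poch_zero]
  | succ n ih =>
    have key : ∀ k ∈ Finset.range (n + 2),
        (-1) ^ k * ((n + 1).choose k : ℂ) * poch b k * poch (c + k) (n + 1 - k) =
        (-1) ^ k * (n.choose k : ℂ) * poch b k * poch (c + k) (n + 1 - k) +
        (if k = 0 then 0 else
          (-1) ^ k * (n.choose (k - 1) : ℂ) * poch b k * poch (c + k) (n + 1 - k)) := by
      intro k _
      rcases k with _ | k
      · simp
      · rw [if_neg (Nat.succ_ne_zero k), Nat.choose_succ_succ']
        rw [Nat.add_sub_cancel]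
        push_cast
        ring
    rw [Finset.sum_congr rfl key, Finset.sum_add_distrib, Finset.sum_range_succ,
      Finset.sum_range_succ' (n := n + 1)]
    simp only [Nat.choose_succ_self, Nat.cast_zero, mul_zero, zero_mul, add_zero, if_true,
      Nat.add_sub_cancel, Nat.succ_ne_zero, if_false]
    have h1 : ∀ k ∈ Finset.range (n + 1),
        (-1) ^ k * (n.choose k : ℂ) * poch b k * poch (c + k) (n + 1 - k) =
          (c + n) * ((-1) ^ k * (n.choose k : ℂ) * poch b k * poch (c + k) (n - k)) := by
      intro k hk
      have hk' : k ≤ n := by simpa [Nat.lt_succ_iff] using hk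
      rw [Nat.sub_add_comm hk', poch_succ, Nat.cast_sub hk']
      ring
    have h2 : ∀ k ∈ Finset.range (n + 1),
        (-1) ^ (k + 1) * (n.choose k : ℂ) * poch b (k + 1) *
          poch (c + ((k + 1 : ℕ) : ℂ)) (n + 1 - (k + 1)) =
          -b * ((-1) ^ k * (n.choose k : ℂ) * poch (b + 1) k *
            poch (c + 1 + k) (n - k)) := by
      intro k _
      rw [poch_succ', Nat.add_sub_add_right]
      push_cast
      rw [show c + ((k : ℂ) + 1) = c + 1 + k by ring]
      ring
    rw [Finset.sum_congr rfl h1, Finset.sum_congr rfl h2, ← Finset.mul_sum, ← Finset.mul_sum, ih, ih,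
      show c + 1 - (b + 1) = c - b by ring, poch_succ]
    ring

/-- The Chu–Vandermonde summation of a terminating `₂F₁` at `1`. -/
theorem chu_vandermonde (n : ℕ) (b : ℂ) {c : ℂ} (hc : 0 < c.re) :
    ∑ k ∈ Finset.range (n + 1), poch (-(n : ℂ)) k * poch b k / (poch c k * (k.factorial : ℂ)) =
      poch (c - b) n / poch c n := by
  have hc0 := poch_ne_zero hc
  rw [eq_div_iff (hc0 n), ← sum_choose_mul_poch, Finset.sum_mul]
  refine Finset.sum_congr rfl fun k hk => ?_
  have hk' : k ≤ n := by simpa [Nat.lt_succ_iff] using hk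
  have h1 : poch c n = poch c k * poch (c + k) (n - k) := by
    obtain ⟨m, rfl⟩ := Nat.exists_eq_add_of_le hk'
    simp only [poch, Finset.prod_range_add, Nat.add_sub_cancel_left]
    congr 1
    exact Finset.prod_congr rfl fun i _ => by push_cast; ring
  have h2 : (n.descFactorial k : ℂ) = k.factorial * n.choose k := by
    exact_mod_cast Nat.descFactorial_eq_factorial_mul_choose n k
  have hf : (k.factorial : ℂ) ≠ 0 := by exact_mod_cast Nat.factorial_ne_zero k
  rw [poch_neg_nat_eq, h1, h2]
  have := hc0 k
  field_simp

theorem poch_one (n : ℕ) : poch 1 n = n.factorial := by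
  induction n with
  | zero => simp [poch_zero]
  | succ n ih => rw [poch_succ, ih, Nat.factorial_succ]; push_cast; ring

/-- The polynomial `(x - i)^m ₂F₁[-m, b, c; 2/(1+ix)]`. -/
def hyperPoly (m : ℕ) (b c : ℂ) : Polynomial ℂ :=
  ∑ k ∈ Finset.range (m + 1), Polynomial.C ((-I) ^ m * (poch (-(m : ℂ)) k * poch b k /
    (poch c k * (k.factorial : ℂ)) * 2 ^ k)) * (1 + Polynomial.C I * Polynomial.X) ^ (m - k)

theorem natDegree_one_add_C_mul_X_pow_le (j : ℕ) :
    ((1 + Polynomial.C I * Polynomial.X) ^ j).natDegree ≤ j := by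
  refine (Polynomial.natDegree_pow_le_of_le j (m := 1) ?_).trans (by simp)
  compute_degree

theorem natDegree_hyperPoly_le (m : ℕ) (b c : ℂ) : (hyperPoly m b c).natDegree ≤ m := by
  refine Polynomial.natDegree_sum_le_of_forall_le _ _ fun k _ => ?_
  refine (Polynomial.natDegree_C_mul_le _ _).trans ?_
  exact (natDegree_one_add_C_mul_X_pow_le _).trans (Nat.sub_le _ _)

theorem coeff_hyperPoly_self (m : ℕ) (b c : ℂ) : (hyperPoly m b c).coeff m = 1 := by
  rw [hyperPoly, Polynomial.finsetSum_coeff, Finset.sum_eq_single 0]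
  · have h1 : ((1 + Polynomial.C I * Polynomial.X) ^ m).coeff m = I ^ m := by
      have := Polynomial.coeff_pow_of_natDegree_le
        (p := (1 + Polynomial.C I * Polynomial.X : Polynomial ℂ)) (m := m) (n := 1)
        (by compute_degree)
      rw [mul_one] at this
      rw [this]
      simp [Polynomial.coeff_one]
    rw [Polynomial.coeff_C_mul, Nat.sub_zero, h1]
    simp only [poch_zero, Nat.factorial_zero, Nat.cast_one, mul_one, div_one, pow_zero]
    rw [← mul_pow]
    simp
  · intro k hk hk0
    rw [Polynomial.coeff_C_mul, Polynomial.coeff_eq_zero_of_natDegree_lt, mul_zero]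
    refine (natDegree_one_add_C_mul_X_pow_le _).trans_lt ?_
    simp only [Finset.mem_range] at hk
    omega
  · simp

theorem eval_hyperPoly (m : ℕ) (b c : ℂ) (z : ℂ) :
    (hyperPoly m b c).eval z = ∑ k ∈ Finset.range (m + 1), (-I) ^ m *
      (poch (-(m : ℂ)) k * poch b k / (poch c k * (k.factorial : ℂ)) * 2 ^ k) *
        (1 + I * z) ^ (m - k) := by
  simp [hyperPoly, Polynomial.eval_finsetSum]

theorem eval_hyperPoly_mul_cauchyFun (m : ℕ) (b c B : ℂ) (x : ℝ) :
    (hyperPoly m b c).eval (x : ℂ) * cauchyFun (b + m) B x =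
      ∑ k ∈ Finset.range (m + 1), (-I) ^ m *
        (poch (-(m : ℂ)) k * poch b k / (poch c k * (k.factorial : ℂ)) * 2 ^ k) *
          cauchyFun (b + k) B x := by
  rw [eval_hyperPoly, Finset.sum_mul]
  refine Finset.sum_congr rfl fun k hk => ?_
  have hk' : k ≤ m := by simpa [Nat.lt_succ_iff] using hk
  have h := pow_mul_cauchyFun (b + m) B (m - k) 0 x
  rw [pow_zero, mul_one, Nat.cast_sub hk', Nat.cast_zero, sub_zero,
    show b + m - (m - k) = b + k by ring] at h
  rw [← h]
  ring

theorem integrable_hyperPoly_mul_cauchyFun (m : ℕ) {b B : ℂ} (c : ℂ) (h : 1 < (b + B).re) :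
    Integrable fun x : ℝ => (hyperPoly m b c).eval (x : ℂ) * cauchyFun (b + m) B x := by
  simp only [eval_hyperPoly_mul_cauchyFun]
  refine integrable_finsetSum _ fun k _ => (integrable_cauchyFun ?_).const_mul _
  simp at h ⊢
  have : (0 : ℝ) ≤ k := by positivity
  linarith

theorem integral_hyperPoly_mul_cauchyFun (m : ℕ) {b B c : ℂ} (hc : 0 < c.re) (hB : 0 < B.re)
    (h : 1 < (b + B).re) :
    ∫ x : ℝ, (hyperPoly m b c).eval (x : ℂ) * cauchyFun (b + m) B x =
      (-I) ^ m * (2 * Real.pi * 2 ^ (1 - b - B) * Gamma (b + B - 1) * (Gamma b)⁻¹ * (Gamma B)⁻¹) *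
        (poch (c - (b + B - 1)) m / poch c m) := by
  have hk : ∀ k : ℕ, 1 < (b + k + B).re := fun k => by
    simp at h ⊢
    have : (0 : ℝ) ≤ k := by positivity
    linarith
  simp only [eval_hyperPoly_mul_cauchyFun]
  rw [integral_finsetSum _ fun k _ => (integrable_cauchyFun (hk k)).const_mul _,
    ← chu_vandermonde m _ hc, Finset.mul_sum]
  refine Finset.sum_congr rfl fun k _ => ?_
  rw [integral_const_mul, integral_cauchyFun hB (hk k), Gamma_inv_eq_poch_mul b k,
    show b + k + B - 1 = b + B - 1 + k by ring,
    Gamma_add_nat_eq_poch_mul (s := b + B - 1) (by simp at h ⊢; linarith),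
    show 1 - (b + k) - B = (1 - b - B) - k by ring, cpow_sub _ _ two_ne_zero, cpow_natCast]
  have h2 : (2 : ℂ) ^ k ≠ 0 := pow_ne_zero k two_ne_zero
  simp only [one_div]
  field_simp

/-- The moments of the generalized Cauchy weight. -/
def cauchyMoment (s : ℂ) (N : ℕ) (j : ℕ) : ℝ := ∫ x, x ^ j * wH s N x

theorem continuous_wH (s : ℂ) (N : ℕ) : Continuous (wH s N) := by
  have h : Continuous fun x => (wH s N x : ℂ) := by
    simp only [ofReal_wH]; exact continuous_cauchyFun _ _
  exact (Complex.continuous_re.comp h).congr fun x => by simp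

theorem integrable_pow_mul_wH {s : ℂ} (hs : -(1 / 2 : ℝ) < s.re) {N j : ℕ} (hj : j + 2 ≤ 2 * N) :
    Integrable fun x : ℝ => x ^ j * wH s N x := by
  have h1 := integrable_rpow_neg_one_add_norm_sq (E := ℝ) (μ := volume) (r := 2 * s.re + 2)
    (by simp; linarith)
  refine (h1.const_mul (Real.exp (Real.pi * |s.im|) * Real.exp (Real.pi * |s.im|))).mono'
    (by have := continuous_wH s N; fun_prop) (Eventually.of_forall fun x => ?_)
  have h2 := norm_cauchyFun_le (s + N) ((starRingEnd ℂ) s + N) x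
  rw [← ofReal_wH, norm_real] at h2
  have h0 : 1 ≤ 1 + x ^ 2 := by nlinarith [sq_nonneg x]
  have h3 : |x| ^ j ≤ (1 + x ^ 2) ^ ((N : ℝ) - 1) := by
    have hx : |x| ≤ (1 + x ^ 2) ^ (1 / 2 : ℝ) := by
      rw [← Real.sqrt_eq_rpow]
      exact Real.abs_le_sqrt (by linarith)
    calc |x| ^ j ≤ ((1 + x ^ 2) ^ (1 / 2 : ℝ)) ^ j := by gcongr
      _ = (1 + x ^ 2) ^ (1 / 2 * (j : ℝ)) := by rw [Real.rpow_mul_natCast (by linarith)]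
      _ ≤ _ := by
        refine Real.rpow_le_rpow_of_exponent_le h0 ?_
        have : ((j : ℝ) + 2) ≤ 2 * N := by exact_mod_cast hj
        linarith
  simp only [norm_mul, norm_pow, Real.norm_eq_abs] at h2 ⊢
  have h4 : (1 + |x| ^ 2) ^ (-(2 * s.re + 2) / 2) =
      (1 + x ^ 2) ^ ((N : ℝ) - 1) * (1 + x ^ 2) ^ (-(s + N + ((starRingEnd ℂ) s + N)).re / 2) := by
    rw [← Real.rpow_add (by linarith)]
    rw [sq_abs]
    congr 1
    simp
    ring
  rw [h4]
  simp only [add_im, natCast_im, conj_im, add_zero, abs_neg] at h2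
  calc _ ≤ (1 + x ^ 2) ^ ((N : ℝ) - 1) * _ := mul_le_mul h3 h2 (abs_nonneg _) (by positivity)
    _ = _ := by ring

theorem sum_coeff_mul_cauchyMoment {s : ℂ} (hs : -(1 / 2 : ℝ) < s.re) {N M l : ℕ}
    (hM : M + l + 2 ≤ 2 * N) {P : Polynomial ℂ} (hP : P.natDegree ≤ M) :
    ∑ j ∈ Finset.range (M + 1), P.coeff j * (cauchyMoment s N (j + l) : ℂ) =
      ∫ x : ℝ, P.eval (x : ℂ) * (x : ℂ) ^ l * wH s N x := by
  have h1 : ∀ x : ℝ, P.eval (x : ℂ) * (x : ℂ) ^ l * wH s N x =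
      ∑ j ∈ Finset.range (M + 1), P.coeff j * ((x ^ (j + l) * wH s N x : ℝ) : ℂ) := by
    intro x
    rw [Polynomial.eval_eq_sum_range' (Nat.lt_succ_of_le hP), Finset.sum_mul, Finset.sum_mul]
    refine Finset.sum_congr rfl fun j _ => ?_
    push_cast
    ring
  simp only [h1]
  rw [integral_finsetSum]
  · refine Finset.sum_congr rfl fun j _ => ?_
    rw [integral_const_mul, integral_complex_ofReal, cauchyMoment]
  · intro j hj
    have hj' : j ≤ M := by simpa [Nat.lt_succ_iff] using hj
    exact (integrable_pow_mul_wH hs (by omega)).ofReal.const_mul _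

theorem integral_mul_pow_eq {f : ℝ → ℂ} {l : ℕ}
    (hint : ∀ m ≤ l, Integrable fun x : ℝ => f x * (1 - I * x) ^ m)
    (h : ∀ m < l, ∫ x : ℝ, f x * (1 - I * x) ^ m = 0) :
    ∫ x : ℝ, f x * (x : ℂ) ^ l = I ^ l * ∫ x : ℝ, f x * (1 - I * x) ^ l := by
  have h1 : ∀ x : ℝ, f x * (x : ℂ) ^ l = ∑ m ∈ Finset.range (l + 1),
      I ^ l * ((-1) ^ (l - m) * (l.choose m : ℂ)) * (f x * (1 - I * x) ^ m) := by
    intro x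
    have : (x : ℂ) = I * ((1 - I * x) + -1) := by linear_combination (x : ℂ) * I_sq
    conv_lhs => rw [this, mul_pow, add_pow, Finset.mul_sum, Finset.mul_sum]
    refine Finset.sum_congr rfl fun m _ => by ring
  simp only [h1]
  rw [integral_finsetSum, Finset.sum_range_succ, Finset.sum_eq_zero]
  · rw [integral_const_mul]
    simp
  · intro m hm
    rw [integral_const_mul, h m (Finset.mem_range.1 hm), mul_zero]
  · intro m hm
    exact (hint m (by simpa [Nat.lt_succ_iff] using hm)).const_mul _

section Bezout

variable {R : Type*} [CommRing R]

/-- Coefficients of the Bezoutian `(q(x)p(y) - p(x)q(y))/(x - y)`. -/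
def bezoutCoeff (p q : ℕ → R) (i j : ℕ) : R :=
  ∑ t ∈ Finset.range (j + 1), (q (i + 1 + t) * p (j - t) - p (i + 1 + t) * q (j - t))

theorem bezoutCoeff_zero_right (p q : ℕ → R) (i : ℕ) :
    bezoutCoeff p q i 0 = q (i + 1) * p 0 - p (i + 1) * q 0 := by
  simp [bezoutCoeff]

theorem bezoutCoeff_succ_right (p q : ℕ → R) (i j : ℕ) :
    bezoutCoeff p q i (j + 1) = q (i + 1) * p (j + 1) - p (i + 1) * q (j + 1) +
      bezoutCoeff p q (i + 1) j := by
  rw [bezoutCoeff, Finset.sum_range_succ', add_comm, bezoutCoeff]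
  congr 1
  refine Finset.sum_congr rfl fun t _ => ?_
  rw [Nat.add_sub_add_right, show i + 1 + (t + 1) = i + 1 + 1 + t by ring]

theorem bezoutCoeff_zero_left (p q : ℕ → R) (j : ℕ) :
    bezoutCoeff p q 0 j = -(q 0 * p (j + 1) - p 0 * q (j + 1)) := by
  have h : ∑ t ∈ Finset.range (j + 1 + 1), (q t * p (j + 1 - t) - p t * q (j + 1 - t)) = 0 := by
    rw [Finset.sum_sub_distrib, sub_eq_zero, ← Finset.sum_range_reflect]
    refine Finset.sum_congr rfl fun t ht => ?_
    have ht' : t ≤ j + 1 := by simpa [Nat.lt_succ_iff] using ht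
    rw [show j + 1 + 1 - 1 - t = j + 1 - t by omega, show j + 1 - (j + 1 - t) = t by omega]
    ring
  rw [Finset.sum_range_succ'] at h
  rw [← add_eq_zero_iff_eq_neg, bezoutCoeff]
  simpa [Nat.add_sub_add_right, add_comm] using h

theorem bezoutCoeff_of_le_left {p q : ℕ → R} {N : ℕ} (hp : ∀ i, N < i → p i = 0)
    (hq : ∀ i, N < i → q i = 0) {i : ℕ} (hi : N ≤ i) (j : ℕ) : bezoutCoeff p q i j = 0 :=
  Finset.sum_eq_zero fun t _ => by
    rw [hp (i + 1 + t) (by omega), hq (i + 1 + t) (by omega)]; ring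

theorem bezoutCoeff_of_le_right {p q : ℕ → R} {N : ℕ} (hp : ∀ i, N < i → p i = 0)
    (hq : ∀ i, N < i → q i = 0) (i : ℕ) {j : ℕ} (hj : N ≤ j) : bezoutCoeff p q i j = 0 := by
  induction i generalizing j with
  | zero => rw [bezoutCoeff_zero_left, hp (j + 1) (by omega), hq (j + 1) (by omega)]; ring
  | succ i ih =>
    have h := bezoutCoeff_succ_right p q i j
    rw [ih (by omega), hp (j + 1) (by omega), hq (j + 1) (by omega)] at h
    simpa using h.symm

theorem sum_bezoutCoeff_mul_succ_succ {p q : ℕ → R} {N : ℕ} (hp : ∀ i, N < i → p i = 0)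
    (hq : ∀ i, N < i → q i = 0) (μ : ℕ → R) (i l : ℕ)
    (hpl : ∑ j ∈ Finset.range (N + 1), p j * μ (j + l) = 0)
    (hql : ∑ j ∈ Finset.range (N + 1), q j * μ (j + l) = 0) :
    ∑ j ∈ Finset.range N, bezoutCoeff p q (i + 1) j * μ (j + (l + 1)) =
      ∑ j ∈ Finset.range N, bezoutCoeff p q i j * μ (j + l) := by
  have h1 : ∑ j ∈ Finset.range (N + 1), bezoutCoeff p q i j * μ (j + l) =
      ∑ j ∈ Finset.range N, bezoutCoeff p q i j * μ (j + l) := by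
    rw [Finset.sum_range_succ, bezoutCoeff_of_le_right hp hq i le_rfl]
    ring
  have h2 : ∑ j ∈ Finset.range (N + 1), (q (i + 1) * p j - p (i + 1) * q j) * μ (j + l) = 0 := by
    have : ∑ j ∈ Finset.range (N + 1), (q (i + 1) * p j - p (i + 1) * q j) * μ (j + l) =
        q (i + 1) * ∑ j ∈ Finset.range (N + 1), p j * μ (j + l) -
          p (i + 1) * ∑ j ∈ Finset.range (N + 1), q j * μ (j + l) := by
      rw [Finset.mul_sum, Finset.mul_sum, ← Finset.sum_sub_distrib]
      exact Finset.sum_congr rfl fun j _ => by ring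
    rw [this, hpl, hql]
    ring
  have h3 : ∑ j ∈ Finset.range (N + 1), (q (i + 1) * p j - p (i + 1) * q j) * μ (j + l) =
      ∑ j ∈ Finset.range (N + 1), bezoutCoeff p q i j * μ (j + l) -
        ∑ j ∈ Finset.range N, bezoutCoeff p q (i + 1) j * μ (j + (l + 1)) := by
    rw [Finset.sum_range_succ', Finset.sum_range_succ', bezoutCoeff_zero_right,
      add_sub_right_comm, ← Finset.sum_sub_distrib]
    congr 1
    refine Finset.sum_congr rfl fun j _ => ?_
    rw [bezoutCoeff_succ_right, show j + 1 + l = j + (l + 1) by ring]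
    ring
  rw [h2, h1] at h3
  exact (sub_eq_zero.1 h3.symm).symm

theorem sum_bezoutCoeff_zero_mul_succ {p q : ℕ → R} {N : ℕ} (μ : ℕ → R) (l : ℕ)
    (hpl : ∑ j ∈ Finset.range (N + 1), p j * μ (j + l) = 0)
    (hql : ∑ j ∈ Finset.range (N + 1), q j * μ (j + l) = 0) :
    ∑ j ∈ Finset.range N, bezoutCoeff p q 0 j * μ (j + (l + 1)) = 0 := by
  have h2 : ∑ j ∈ Finset.range (N + 1), (q 0 * p j - p 0 * q j) * μ (j + l) = 0 := by
    have : ∑ j ∈ Finset.range (N + 1), (q 0 * p j - p 0 * q j) * μ (j + l) =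
        q 0 * ∑ j ∈ Finset.range (N + 1), p j * μ (j + l) -
          p 0 * ∑ j ∈ Finset.range (N + 1), q j * μ (j + l) := by
      rw [Finset.mul_sum, Finset.mul_sum, ← Finset.sum_sub_distrib]
      exact Finset.sum_congr rfl fun j _ => by ring
    rw [this, hpl, hql]
    ring
  rw [Finset.sum_range_succ', mul_comm (q 0) (p 0), sub_self, zero_mul, add_zero] at h2
  rw [← neg_eq_zero, ← h2, ← Finset.sum_neg_distrib]
  refine Finset.sum_congr rfl fun j _ => ?_
  rw [bezoutCoeff_zero_left, show j + 1 + l = j + (l + 1) by ring]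
  ring

/-- The Bezoutian of two orthogonal polynomials inverts the Hankel matrix of the moments. -/
theorem sum_bezoutCoeff_mul_moment {p q : ℕ → R} {n : ℕ} {h : R} (hp : ∀ i, n < i → p i = 0)
    (hq : ∀ i, n + 1 < i → q i = 0) (hq1 : q (n + 1) = 1) (μ : ℕ → R)
    (hpl : ∀ l < n, ∑ j ∈ Finset.range (n + 1), p j * μ (j + l) = 0)
    (hql : ∀ l < n, ∑ j ∈ Finset.range (n + 2), q j * μ (j + l) = 0)
    (hh : ∑ j ∈ Finset.range (n + 1), p j * μ (j + n) = h) {i l : ℕ} (hi : i ≤ n) (hl : l ≤ n) :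
    ∑ j ∈ Finset.range (n + 1), bezoutCoeff p q i j * μ (j + l) = if i = l then h else 0 := by
  have hp' : ∀ i, n + 1 < i → p i = 0 := fun i hi => hp i (by omega)
  have hpl' : ∀ l < n, ∑ j ∈ Finset.range (n + 1 + 1), p j * μ (j + l) = 0 := fun l hl => by
    rw [Finset.sum_range_succ, hpl l hl, hp (n + 1) (by omega)]; ring
  have shift : ∀ k i l, l + k ≤ n →
      ∑ j ∈ Finset.range (n + 1), bezoutCoeff p q (i + k) j * μ (j + (l + k)) =
      ∑ j ∈ Finset.range (n + 1), bezoutCoeff p q i j * μ (j + l) := by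
    intro k i l
    induction k with
    | zero => simp
    | succ k ih =>
      intro hk
      rw [← ih (by omega), ← sum_bezoutCoeff_mul_succ_succ hp' hq μ (i + k) (l + k)
        (hpl' _ (by omega)) (hql _ (by omega))]
      simp only [add_assoc]
  have last : ∀ j, bezoutCoeff p q n j = p j := by
    intro j
    rcases j with _ | j
    · rw [bezoutCoeff_zero_right, hq1, hp (n + 1) (by omega)]; ring
    · rw [bezoutCoeff_succ_right, bezoutCoeff_of_le_left hp' hq le_rfl, hq1, hp (n + 1) (by omega)]
      ring
  rcases le_or_gt l i with h1 | h1
  · have h2 := shift (n - i) i l (by omega)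
    rw [← h2, show i + (n - i) = n by omega]
    simp only [last]
    split_ifs with h3
    · rw [← hh, show l + (n - i) = n by omega]
    · exact hpl _ (by omega)
  · obtain ⟨d, rfl⟩ := Nat.exists_eq_add_of_lt h1
    have h2 := shift i 0 (d + 1) (by omega)
    rw [if_neg (by omega), show i + d + 1 = d + 1 + i by ring]
    rw [zero_add] at h2
    rw [h2]
    exact sum_bezoutCoeff_zero_mul_succ μ d (hpl' _ (by omega)) (hql _ (by omega))

theorem sub_mul_sum_bezoutCoeff {p q : ℕ → R} {N : ℕ} (hp : ∀ i, N < i → p i = 0)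
    (hq : ∀ i, N < i → q i = 0) (x y : R) :
    (x - y) * ∑ i ∈ Finset.range N, ∑ j ∈ Finset.range N, bezoutCoeff p q i j * x ^ i * y ^ j =
      (∑ i ∈ Finset.range (N + 1), q i * x ^ i) * (∑ i ∈ Finset.range (N + 1), p i * y ^ i) -
      (∑ i ∈ Finset.range (N + 1), p i * x ^ i) * (∑ i ∈ Finset.range (N + 1), q i * y ^ i) := by
  have row : ∀ i, ∑ j ∈ Finset.range (N + 1), (q (i + 1) * p j - p (i + 1) * q j) * y ^ j =
      ∑ j ∈ Finset.range N, bezoutCoeff p q i j * y ^ j -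
        y * ∑ j ∈ Finset.range N, bezoutCoeff p q (i + 1) j * y ^ j := by
    intro i
    have h1 : ∑ j ∈ Finset.range (N + 1), bezoutCoeff p q i j * y ^ j =
        ∑ j ∈ Finset.range N, bezoutCoeff p q i j * y ^ j := by
      rw [Finset.sum_range_succ, bezoutCoeff_of_le_right hp hq i le_rfl]
      ring
    rw [← h1, Finset.sum_range_succ', Finset.sum_range_succ', bezoutCoeff_zero_right,
      Finset.mul_sum, add_sub_right_comm, ← Finset.sum_sub_distrib]
    congr 1
    refine Finset.sum_congr rfl fun j _ => ?_
    rw [bezoutCoeff_succ_right]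
    ring
  have row0 : ∑ j ∈ Finset.range (N + 1), (q 0 * p j - p 0 * q j) * y ^ j =
      - (y * ∑ j ∈ Finset.range N, bezoutCoeff p q 0 j * y ^ j) := by
    rw [Finset.sum_range_succ', Finset.mul_sum, ← Finset.sum_neg_distrib, mul_comm (q 0) (p 0),
      sub_self, zero_mul, add_zero]
    refine Finset.sum_congr rfl fun j _ => ?_
    rw [bezoutCoeff_zero_left]
    ring
  have hR : (∑ i ∈ Finset.range (N + 1), q i * x ^ i) * (∑ i ∈ Finset.range (N + 1), p i * y ^ i) -
      (∑ i ∈ Finset.range (N + 1), p i * x ^ i) * (∑ i ∈ Finset.range (N + 1), q i * y ^ i) =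
      ∑ i ∈ Finset.range (N + 1), x ^ i *
        ∑ j ∈ Finset.range (N + 1), (q i * p j - p i * q j) * y ^ j := by
    rw [Finset.sum_mul, Finset.sum_mul, ← Finset.sum_sub_distrib]
    refine Finset.sum_congr rfl fun i _ => ?_
    rw [Finset.mul_sum, Finset.mul_sum, Finset.mul_sum, ← Finset.sum_sub_distrib]
    exact Finset.sum_congr rfl fun j _ => by ring
  have hL : ∀ i, ∑ j ∈ Finset.range N, bezoutCoeff p q i j * x ^ i * y ^ j =
      x ^ i * ∑ j ∈ Finset.range N, bezoutCoeff p q i j * y ^ j := fun i => by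
    rw [Finset.mul_sum]
    exact Finset.sum_congr rfl fun j _ => by ring
  rw [hR, Finset.sum_range_succ', row0]
  simp only [row, hL]
  have hN : ∑ i ∈ Finset.range (N + 1), x ^ i * ∑ j ∈ Finset.range N, bezoutCoeff p q i j * y ^ j =
      ∑ i ∈ Finset.range N, x ^ i * ∑ j ∈ Finset.range N, bezoutCoeff p q i j * y ^ j := by
    rw [Finset.sum_range_succ]
    simp only [bezoutCoeff_of_le_left hp hq le_rfl, zero_mul, Finset.sum_const_zero, mul_zero,
      add_zero]
  rw [sub_mul]
  conv_lhs => arg 2; rw [← hN, Finset.sum_range_succ']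
  rw [mul_add, ← sub_sub, Finset.mul_sum, Finset.mul_sum, ← Finset.sum_sub_distrib, pow_zero,
    one_mul, one_mul, sub_eq_add_neg _ (y * _)]
  congr 1
  exact Finset.sum_congr rfl fun i _ => by ring

end Bezout

theorem conj_eq_sub (s : ℂ) : (starRingEnd ℂ) s = 2 * (s.re : ℂ) - s := by
  have := Complex.add_conj s
  push_cast at this
  linear_combination this

theorem eval_mul_wH_mul_pow (P : Polynomial ℂ) (s : ℂ) (N m : ℕ) (x : ℝ) :
    P.eval (x : ℂ) * wH s N x * (1 - I * x) ^ m =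
      P.eval (x : ℂ) * cauchyFun (s + N) ((starRingEnd ℂ) s + N - m) x := by
  have h := pow_mul_cauchyFun (s + N) ((starRingEnd ℂ) s + N) 0 m x
  rw [pow_zero, one_mul, Nat.cast_zero, sub_zero] at h
  rw [ofReal_wH, ← h]
  ring

theorem sum_coeff_hyperPoly_mul_cauchyMoment {s : ℂ} (hs : -(1 / 2 : ℝ) < s.re) {N M l : ℕ}
    {b c : ℂ} (hc : 0 < c.re) (hb : b + M = s + N) (hM : M + l + 2 ≤ 2 * N) (hl : l < N)
    (h : ∀ m < l, poch (c - (b + ((starRingEnd ℂ) s + N - m) - 1)) M = 0) :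
    ∑ j ∈ Finset.range (M + 1), (hyperPoly M b c).coeff j * (cauchyMoment s N (j + l) : ℂ) =
      I ^ l * ((-I) ^ M * (2 * Real.pi * 2 ^ (1 - b - ((starRingEnd ℂ) s + N - l)) *
        Gamma (b + ((starRingEnd ℂ) s + N - l) - 1) * (Gamma b)⁻¹ *
        (Gamma ((starRingEnd ℂ) s + N - l))⁻¹) *
        (poch (c - (b + ((starRingEnd ℂ) s + N - l) - 1)) M / poch c M)) := by
  have hbre : b.re + M = s.re + N := by simpa using congrArg re hb
  have hM' : (M : ℝ) + l + 2 ≤ 2 * N := by exact_mod_cast hM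
  have hre : ∀ m ≤ l, 0 < ((starRingEnd ℂ) s + N - m).re ∧
      1 < (b + ((starRingEnd ℂ) s + N - m)).re := by
    intro m hm
    have h1 : (m : ℝ) ≤ l := by exact_mod_cast hm
    have h2 : (l : ℝ) + 1 ≤ N := by exact_mod_cast hl
    simp only [add_re, sub_re, conj_re, natCast_re]
    constructor <;> linarith
  rw [sum_coeff_mul_cauchyMoment hs hM (natDegree_hyperPoly_le M b c)]
  simp only [mul_right_comm _ ((_ : ℂ) ^ l)]
  rw [integral_mul_pow_eq]
  · simp only [eval_mul_wH_mul_pow, ← hb]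
    rw [integral_hyperPoly_mul_cauchyFun M hc (hre l le_rfl).1 (hre l le_rfl).2]
  · intro m hm
    simp only [eval_mul_wH_mul_pow, ← hb]
    exact integrable_hyperPoly_mul_cauchyFun M c (hre m hm).2
  · intro m hm
    simp only [eval_mul_wH_mul_pow, ← hb]
    rw [integral_hyperPoly_mul_cauchyFun M hc (hre m hm.le).1 (hre m hm.le).2, h m hm]
    simp

/-- The polynomial `p_{N-1}` for `N = n + 1`. -/
def polyP (s : ℂ) (n : ℕ) : Polynomial ℂ := hyperPoly n (s + 1) ((2 * s.re + 2 : ℝ) : ℂ)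

/-- The polynomial `p̃_N` for `N = n + 1`. -/
def polyQ (s : ℂ) (n : ℕ) : Polynomial ℂ := hyperPoly (n + 1) s ((2 * s.re + 1 : ℝ) : ℂ)

theorem CNs_succ_ne_zero {s : ℂ} (hs : -(1 / 2 : ℝ) < s.re) (n : ℕ) : CNs s (n + 1) ≠ 0 := by
  have hn : (0 : ℝ) ≤ n := by positivity
  have h : ∀ z : ℂ, 0 < z.re → Gamma z ≠ 0 := fun z hz => Gamma_ne_zero_of_re_pos hz
  unfold CNs
  refine mul_ne_zero (ofReal_ne_zero.2 (by positivity)) (div_ne_zero (mul_ne_zero (mul_ne_zero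
    (h _ ?_) (h _ ?_)) (h _ ?_)) (mul_ne_zero (mul_ne_zero (h _ ?_) (h _ ?_)) (h _ ?_))) <;>
  · simp
    linarith

theorem sum_bezoutCoeff_mul_cauchyMoment {s : ℂ} (hs : -(1 / 2 : ℝ) < s.re) {n i l : ℕ}
    (hi : i ≤ n) (hl : l ≤ n) :
    ∑ j ∈ Finset.range (n + 1), bezoutCoeff (polyP s n).coeff (polyQ s n).coeff i j *
      (cauchyMoment s (n + 1) (j + l) : ℂ) = if i = l then (CNs s (n + 1))⁻¹ else 0 := by
  have hzp : ∀ m < n, ∀ k, n ≤ k → poch (((2 * s.re + 2 : ℝ) : ℂ) -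
      (s + 1 + ((starRingEnd ℂ) s + ((n + 1 : ℕ) : ℂ) - m) - 1)) k = 0 := by
    intro m hm k hk
    rw [← poch_neg_eq_zero (n := n - 1 - m) (k := k) (by omega), conj_eq_sub,
      Nat.cast_sub (by omega), Nat.cast_sub (by omega)]
    push_cast
    congr 1
    ring
  have hzq : ∀ m < n, ∀ k, n ≤ k → poch (((2 * s.re + 1 : ℝ) : ℂ) -
      (s + ((starRingEnd ℂ) s + ((n + 1 : ℕ) : ℂ) - m) - 1)) k = 0 := by
    intro m hm k hk
    rw [← hzp m hm k hk]
    push_cast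
    congr 1
    ring
  have hc2 : 0 < ((2 * s.re + 2 : ℝ) : ℂ).re := by rw [ofReal_re]; linarith
  have hc1 : 0 < ((2 * s.re + 1 : ℝ) : ℂ).re := by rw [ofReal_re]; linarith
  have hbp : s + 1 + (n : ℂ) = s + ((n + 1 : ℕ) : ℂ) := by push_cast; ring
  refine sum_bezoutCoeff_mul_moment (fun i hi => ?_) (fun i hi => ?_) ?_
    (fun j => (cauchyMoment s (n + 1) j : ℂ)) (fun l hl => ?_) (fun l hl => ?_) ?_ hi hl
  · exact Polynomial.coeff_eq_zero_of_natDegree_lt ((natDegree_hyperPoly_le _ _ _).trans_lt hi)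
  · exact Polynomial.coeff_eq_zero_of_natDegree_lt ((natDegree_hyperPoly_le _ _ _).trans_lt hi)
  · exact coeff_hyperPoly_self _ _ _
  · rw [polyP, sum_coeff_hyperPoly_mul_cauchyMoment hs hc2 hbp (by omega) (by omega)
      fun m hm => hzp m (by omega) n le_rfl, hzp l hl n le_rfl]
    simp
  · rw [polyQ, sum_coeff_hyperPoly_mul_cauchyMoment hs hc1 rfl (by omega) (by omega)
      fun m hm => hzq m (by omega) (n + 1) (by omega), hzq l hl (n + 1) (by omega)]
    simp
  · rw [polyP, sum_coeff_hyperPoly_mul_cauchyMoment hs hc2 hbp (by omega) (by omega)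
      fun m hm => hzp m (by omega) n le_rfl]
    have e1 : (starRingEnd ℂ) s + ((n + 1 : ℕ) : ℂ) - n = (starRingEnd ℂ) s + 1 := by
      push_cast; ring
    have e2 : ((2 * s.re + 2 : ℝ) : ℂ) - (s + 1 + ((starRingEnd ℂ) s + 1) - 1) = 1 := by
      rw [conj_eq_sub]; push_cast; ring
    have e3 : s + 1 + ((starRingEnd ℂ) s + 1) - 1 = ((2 * s.re + 1 : ℝ) : ℂ) := by
      rw [conj_eq_sub]; push_cast; ring
    have e4 : 1 - (s + 1) - ((starRingEnd ℂ) s + 1) = -((2 * s.re : ℝ) : ℂ) - 1 := by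
      rw [conj_eq_sub]; push_cast; ring
    have e5 : ((2 * s.re + (n + 1 : ℕ) + 1 : ℝ) : ℂ) = ((2 * s.re + 2 : ℝ) : ℂ) + n := by
      push_cast; ring
    have hI : I ^ n * (-I) ^ n = 1 := by rw [← mul_pow]; simp
    rw [e1, e2, e3, e4, poch_one, CNs, e5, Gamma_add_nat_eq_poch_mul hc2]
    have hn : Gamma ((n + 1 : ℕ) : ℂ) = n.factorial := by push_cast; exact Gamma_nat_eq_factorial n
    have h2' : (((2 : ℝ) ^ (2 * s.re) : ℝ) : ℂ) = (2 : ℂ) ^ ((2 * s.re : ℝ) : ℂ) := by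
      rw [ofReal_cpow (by norm_num), ofReal_ofNat]
    have h2 : (2 : ℂ) ^ (-((2 * s.re : ℝ) : ℂ) - 1) =
        (2 * (((2 : ℝ) ^ (2 * s.re) : ℝ) : ℂ))⁻¹ := by
      rw [cpow_sub _ _ two_ne_zero, cpow_neg, cpow_one, h2', mul_inv, div_eq_mul_inv, mul_comm]
    rw [hn, h2]
    have hpi : (Real.pi : ℂ) ≠ 0 := ofReal_ne_zero.2 Real.pi_ne_zero
    have g0 : (((2 : ℝ) ^ (2 * s.re) : ℝ) : ℂ) ≠ 0 := ofReal_ne_zero.2 (by positivity)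
    have g1 : Gamma (s + 1) ≠ 0 := Gamma_ne_zero_of_re_pos (by simp; linarith)
    have g2 : Gamma ((starRingEnd ℂ) s + 1) ≠ 0 := Gamma_ne_zero_of_re_pos (by simp; linarith)
    have g3 := Gamma_ne_zero_of_re_pos hc1
    have g4 := Gamma_ne_zero_of_re_pos hc2
    have g5 := poch_ne_zero hc2 n
    have g6 : (n.factorial : ℂ) ≠ 0 := by exact_mod_cast n.factorial_ne_zero
    rw [← mul_assoc, ← mul_assoc, hI, ofReal_div]
    generalize (((2 : ℝ) ^ (2 * s.re) : ℝ) : ℂ) = T at *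
    generalize ((2 * s.re + 2 : ℝ) : ℂ) = c at *
    generalize ((2 * s.re + 1 : ℝ) : ℂ) = d at *
    field_simp

/-- The functions `x^i √w(x)`. -/
def weightedMonomial (s : ℂ) (N i : ℕ) (x : ℝ) : ℝ := x ^ i * √(wH s N x)

theorem weightedMonomial_mul (s : ℂ) (N i j : ℕ) (x : ℝ) :
    weightedMonomial s N i x * weightedMonomial s N j x = x ^ (i + j) * wH s N x := by
  rw [weightedMonomial, weightedMonomial, mul_mul_mul_comm,
    Real.mul_self_sqrt (wH_pos s N x).le, pow_add]

theorem integrable_weightedMonomial_mul {s : ℂ} (hs : -(1 / 2 : ℝ) < s.re) {N i j : ℕ}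
    (hi : i < N) (hj : j < N) :
    Integrable fun x => weightedMonomial s N i x * weightedMonomial s N j x := by
  simp only [weightedMonomial_mul]
  exact integrable_pow_mul_wH hs (by omega)

theorem vandSq_mul_prod_wH (s : ℂ) (N : ℕ) (x : Fin N → ℝ) :
    vandSq N x * ∏ j, wH s N (x j) =
      (Matrix.of fun a b : Fin N => weightedMonomial s N a (x b)).det *
        (Matrix.of fun a b : Fin N => weightedMonomial s N a (x b)).det := by
  have h1 : (Matrix.of fun a b : Fin N => weightedMonomial s N a (x b)) =
      (Matrix.vandermonde x).transpose * Matrix.diagonal fun b => √(wH s N (x b)) := by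
    ext a b
    simp [weightedMonomial, Matrix.mul_diagonal, Matrix.vandermonde_apply]
  have h2 : vandSq N x = (∏ i, ∏ j ∈ Finset.Ioi i, (x j - x i)) ^ 2 := by
    rw [vandSq, Finset.prod_filter, Fintype.prod_prod_type, ← Finset.prod_pow]
    refine Finset.prod_congr rfl fun i _ => ?_
    rw [← Finset.prod_filter, ← Finset.prod_pow]
    refine Finset.prod_congr ?_ fun j _ => by ring
    ext j
    simp
  have h3 : ∏ j, wH s N (x j) = (∏ j, √(wH s N (x j))) ^ 2 := by
    rw [← Finset.prod_pow]
    exact Finset.prod_congr rfl fun j _ => (Real.sq_sqrt (wH_pos s N _).le).symm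
  rw [h1, Matrix.det_mul, Matrix.det_transpose, Matrix.det_vandermonde, Matrix.det_diagonal, h2, h3]
  ring

theorem integral_vandSq_mul_prod_wH {s : ℂ} (hs : -(1 / 2 : ℝ) < s.re) (N : ℕ) (S : Set ℝ) :
    ∫ x : Fin N → ℝ in Set.univ.pi fun _ => S, vandSq N x * ∏ j, wH s N (x j) =
      N.factorial * (Matrix.of fun a b : Fin N =>
        ∫ x in S, weightedMonomial s N b x * weightedMonomial s N a x).det := by
  simp only [vandSq_mul_prod_wH]
  rw [volume_pi, Measure.restrict_pi_pi]
  exact andreief (volume.restrict S) (fun a : Fin N => weightedMonomial s N a)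
    (fun a : Fin N => weightedMonomial s N a) fun a b =>
      (integrable_weightedMonomial_mul hs b.2 a.2).restrict

/-- The Hankel matrix of the moments of the weight. -/
def hankel (s : ℂ) (N : ℕ) : Matrix (Fin N) (Fin N) ℝ :=
  Matrix.of fun i j => cauchyMoment s N (i + j)

theorem bezout_mul_hankel {s : ℂ} (hs : -(1 / 2 : ℝ) < s.re) (n : ℕ) :
    (Matrix.of fun i j : Fin (n + 1) =>
      CNs s (n + 1) * bezoutCoeff (polyP s n).coeff (polyQ s n).coeff i j) *
        (hankel s (n + 1)).map ofReal = 1 := by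
  ext i l
  have h := sum_bezoutCoeff_mul_cauchyMoment hs (Nat.lt_succ_iff.1 i.2) (Nat.lt_succ_iff.1 l.2)
  rw [Matrix.mul_apply, Matrix.one_apply]
  simp only [Matrix.of_apply, Matrix.map_apply, hankel, mul_assoc]
  rw [← Finset.mul_sum, Fin.sum_univ_eq_sum_range (fun j =>
    bezoutCoeff (polyP s n).coeff (polyQ s n).coeff i j * (cauchyMoment s (n + 1) (j + l) : ℂ)), h]
  split_ifs with h1 h2 h2
  · exact mul_inv_cancel₀ (CNs_succ_ne_zero hs n)
  · exact absurd (Fin.ext h1) h2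
  · exact absurd (congrArg Fin.val h2) h1
  · simp

theorem det_hankel_ne_zero {s : ℂ} (hs : -(1 / 2 : ℝ) < s.re) (n : ℕ) :
    (hankel s (n + 1)).det ≠ 0 := by
  intro h
  have h1 := congrArg Matrix.det (bezout_mul_hankel hs n)
  have h2 : ((hankel s (n + 1)).map ofReal).det = (((hankel s (n + 1)).det : ℝ) : ℂ) :=
    (RingHom.map_det ofRealHom _).symm
  rw [Matrix.det_mul, h2, h] at h1
  simp at h1

theorem ofReal_hankel_inv {s : ℂ} (hs : -(1 / 2 : ℝ) < s.re) (n : ℕ) (i j : Fin (n + 1)) :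
    (((hankel s (n + 1))⁻¹ i j : ℝ) : ℂ) =
      CNs s (n + 1) * bezoutCoeff (polyP s n).coeff (polyQ s n).coeff i j := by
  have h1 : (hankel s (n + 1)).map ofReal * ((hankel s (n + 1))⁻¹).map ofReal = 1 := by
    have := congrArg (fun M : Matrix (Fin (n + 1)) (Fin (n + 1)) ℝ => M.map ofRealHom)
      (Matrix.mul_nonsing_inv (hankel s (n + 1)) (isUnit_iff_ne_zero.2 (det_hankel_ne_zero hs n)))
    simp only [Matrix.map_mul, Matrix.map_one _ (map_zero ofRealHom) (map_one ofRealHom)] at this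
    exact this
  have h2 := left_inv_eq_right_inv (bezout_mul_hankel hs n) h1
  have h3 := congrFun (congrFun h2 i) j
  simpa using h3.symm

theorem posSemidef_hankel {s : ℂ} (hs : -(1 / 2 : ℝ) < s.re) (N : ℕ) :
    (hankel s N).PosSemidef := by
  refine Matrix.PosSemidef.of_dotProduct_mulVec_nonneg ?_ fun v => ?_
  · ext i j
    simp [hankel, add_comm]
  · have h1 : star v ⬝ᵥ (hankel s N).mulVec v =
        ∫ x, (∑ i, v i * weightedMonomial s N i x) * ∑ j, v j * weightedMonomial s N j x := by
      have h2 : ∀ x, (∑ i, v i * weightedMonomial s N i x) * ∑ j, v j * weightedMonomial s N j x =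
          ∑ i, ∑ j, v i * v j *
            (weightedMonomial s N i x * weightedMonomial s N j x) := fun x => by
        rw [Finset.sum_mul_sum]
        exact Finset.sum_congr rfl fun i _ => Finset.sum_congr rfl fun j _ => by ring
      simp only [h2]
      rw [integral_finsetSum _ fun i _ => integrable_finsetSum _ fun j _ =>
        (integrable_weightedMonomial_mul hs i.2 j.2).const_mul _]
      simp only [dotProduct, Matrix.mulVec, Finset.mul_sum]
      refine Finset.sum_congr rfl fun i _ => ?_
      rw [integral_finsetSum _ fun j _ => (integrable_weightedMonomial_mul hs i.2 j.2).const_mul _]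
      refine Finset.sum_congr rfl fun j _ => ?_
      rw [integral_const_mul]
      simp only [weightedMonomial_mul, hankel, Matrix.of_apply, cauchyMoment]
      simp
      ring
    rw [h1]
    exact integral_nonneg fun x => mul_self_nonneg _

/-- The Christoffel–Darboux kernel, rescaled by `N`. -/
def scaledKernel (s : ℂ) (N : ℕ) (x y : ℝ) : ℝ :=
  ∑ i : Fin N, √N * weightedMonomial s N i (N * x) *
    ∑ j : Fin N, (hankel s N)⁻¹ i j * (√N * weightedMonomial s N j (N * y))

theorem det_scaledKernel_nonneg_le {s : ℂ} (hs : -(1 / 2 : ℝ) < s.re) (N : ℕ) {k : ℕ}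
    (x : Fin k → ℝ) :
    0 ≤ rhoK (scaledKernel s N) k x ∧
      rhoK (scaledKernel s N) k x ≤ ∏ a, scaledKernel s N (x a) (x a) := by
  let V : Matrix (Fin k) (Fin N) ℝ := Matrix.of fun a i => √N * weightedMonomial s N i (N * x a)
  have h1 : (Matrix.of fun a b => scaledKernel s N (x a) (x b)) =
      V * (hankel s N)⁻¹ * V.conjTranspose := by
    ext a b
    rw [Matrix.mul_assoc, Matrix.mul_apply]
    simp [V, scaledKernel, Matrix.mul_apply]
  have h2 : (Matrix.of fun a b => scaledKernel s N (x a) (x b)).PosSemidef := by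
    rw [h1]
    exact (posSemidef_hankel hs N).inv.mul_mul_conjTranspose_same V
  exact ⟨h2.det_nonneg, h2.det_le_prod_diag⟩

theorem ratio_eq_fredholmDet {s : ℂ} (hs : -(1 / 2 : ℝ) < s.re) (x₀ : ℝ) (n : ℕ) :
    (∫ x : Fin (n + 1) → ℝ in Set.univ.pi fun _ => Set.Iio (((n + 1 : ℕ) : ℝ) * x₀),
        vandSq (n + 1) x * ∏ j, wH s (n + 1) (x j)) /
      ∫ x : Fin (n + 1) → ℝ, vandSq (n + 1) x * ∏ j, wH s (n + 1) (x j) =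
    fredholmDet (scaledKernel s (n + 1)) x₀ := by
  have hden := integral_vandSq_mul_prod_wH hs (n + 1) Set.univ
  rw [Set.pi_univ, setIntegral_univ] at hden
  have hG : (Matrix.of fun a b : Fin (n + 1) => ∫ x in Set.univ,
      weightedMonomial s (n + 1) b x * weightedMonomial s (n + 1) a x) = hankel s (n + 1) := by
    ext a b
    simp [weightedMonomial_mul, hankel, cauchyMoment, add_comm]
  rw [integral_vandSq_mul_prod_wH hs, hden, hG,
    mul_div_mul_left _ _ (by exact_mod_cast (n + 1).factorial_ne_zero)]
  set N := n + 1 with hN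
  have hNpos : (0 : ℝ) < N := by rw [hN]; positivity
  have hu := isUnit_iff_ne_zero.2 (det_hankel_ne_zero hs n)
  let F : Fin N → ℝ → ℝ := fun i x => √N * weightedMonomial s N i (N * x)
  let H : Fin N → ℝ → ℝ := fun i x => ∑ j, (hankel s N)⁻¹ i j * F j x
  have hFF : ∀ a b, Integrable (fun x => F b x * F a x) := by
    intro a b
    have h1 := (integrable_weightedMonomial_mul hs b.2 a.2).comp_mul_left' hNpos.ne'
    refine (h1.const_mul (√N * √N)).congr (Eventually.of_forall fun x => ?_)
    simp only [F]
    ring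
  have hFH : ∀ a b, Integrable (fun x => F b x * H a x) (volume.restrict (Ioi x₀)) := by
    intro a b
    simp only [H, Finset.mul_sum]
    refine integrable_finsetSum _ fun j _ => ?_
    refine ((hFF j b).restrict.const_mul ((hankel s N)⁻¹ a j)).congr
      (Eventually.of_forall fun x => ?_)
    ring
  have hint : ∀ a b : Fin N, ∫ x in Ioi x₀, F b x * F a x =
      ∫ x in Ioi (N * x₀), weightedMonomial s N b x * weightedMonomial s N a x := by
    intro a b
    have h1 := integral_comp_mul_left_Ioi
      (fun x => weightedMonomial s N b x * weightedMonomial s N a x) x₀ hNpos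
    have h2 : ∀ x, F b x * F a x =
        N * (weightedMonomial s N b (N * x) * weightedMonomial s N a (N * x)) := fun x => by
      simp only [F]
      rw [mul_mul_mul_comm, Real.mul_self_sqrt hNpos.le]
    simp only [h2]
    rw [integral_const_mul, h1, smul_eq_mul, mul_inv_cancel_left₀ hNpos.ne']
  have hA : (Matrix.of fun a b : Fin N => ∫ x in Iio ((N : ℝ) * x₀),
      weightedMonomial s N b x * weightedMonomial s N a x) =
      hankel s N * (1 - Matrix.of fun a b => ∫ x in Ioi x₀, F b x * H a x) := by
    have hB : (Matrix.of fun a b => ∫ x in Ioi x₀, F b x * H a x) =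
        (hankel s N)⁻¹ * Matrix.of fun a b => ∫ x in Ioi x₀, F b x * F a x := by
      ext a b
      rw [Matrix.mul_apply]
      simp only [Matrix.of_apply, H, Finset.mul_sum]
      rw [integral_finsetSum]
      · refine Finset.sum_congr rfl fun j _ => ?_
        rw [← integral_const_mul]
        congr 1
        ext x
        ring
      · intro j _
        refine ((hFF j b).restrict.const_mul ((hankel s N)⁻¹ a j)).congr
          (Eventually.of_forall fun x => ?_)
        ring
    rw [hB, Matrix.mul_sub, mul_one, Matrix.mul_nonsing_inv_cancel_left _ _ hu, ← hG]
    ext a b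
    have h1 := (integrable_weightedMonomial_mul hs b.2 a.2)
    have h2 := integral_add_compl (measurableSet_Iio (a := (N : ℝ) * x₀)) h1
    rw [compl_Iio, integral_Ici_eq_integral_Ioi] at h2
    simp only [Matrix.sub_apply, Matrix.of_apply, hint, setIntegral_univ]
    rw [← h2]
    ring
  rw [hA, Matrix.det_mul, mul_div_cancel_left₀ _ hu.ne_zero,
    det_one_sub_eq_fredholm _ _ _ hFH, fredholmDet]
  simp only [volume_pi, Measure.restrict_pi_pi]
  rfl

/-- The damping factor `m(m-1)⋯(m-k+1)/(n+1)^k` with `m = n + 1 - d`. -/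
def damping (d n k : ℕ) : ℝ := ((n + 1 - d).descFactorial k : ℝ) / ((n + 1 : ℕ) : ℝ) ^ k

theorem damping_nonneg (d n k : ℕ) : 0 ≤ damping d n k := by
  unfold damping; positivity

theorem damping_le_one (d n k : ℕ) : damping d n k ≤ 1 := by
  refine div_le_one_of_le₀ ?_ (by positivity)
  exact_mod_cast (Nat.descFactorial_le_pow _ _).trans (Nat.pow_le_pow_left (Nat.sub_le _ _) k)

theorem tendsto_damping (d k : ℕ) : Tendsto (fun n => damping d n k) atTop (nhds 1) := by
  have h1 : ∀ j : ℕ, Tendsto (fun n : ℕ => ((n + 1 - j : ℕ) : ℝ) / ((n + 1 : ℕ) : ℝ)) atTop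
      (nhds 1) := by
    intro j
    have h2 : Tendsto (fun n : ℕ => 1 - (j : ℝ) / ((n + 1 : ℕ) : ℝ)) atTop (nhds (1 - 0)) :=
      tendsto_const_nhds.sub
        ((tendsto_const_div_atTop_nhds_zero_nat (j : ℝ)).comp (tendsto_add_atTop_nat 1))
    rw [sub_zero] at h2
    refine h2.congr' ?_
    filter_upwards [eventually_ge_atTop j] with n hn
    have h3 : ((n + 1 : ℕ) : ℝ) ≠ 0 := by positivity
    rw [Nat.cast_sub (by omega)]
    field_simp
  have h4 := tendsto_finsetProd (Finset.range k) fun i _ => h1 (d + i)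
  rw [Finset.prod_const_one] at h4
  refine h4.congr fun n => ?_
  rw [damping, Nat.descFactorial_eq_prod_range, Finset.prod_div_distrib, Finset.prod_const,
    Finset.card_range, Nat.cast_prod]
  simp only [Nat.sub_sub]

/-- The coefficients of `₁F₁[b, c; ·]`. -/
def kummerCoeff (b c : ℂ) (k : ℕ) : ℂ := poch b k / (poch c k * k.factorial)

theorem norm_kummerCoeff_le (b : ℂ) {c : ℝ} (hc : 0 < c) (k : ℕ) :
    ‖kummerCoeff b c k‖ ≤ (1 + ‖b‖ / c) ^ k / k.factorial := by
  have hp : ∀ k, ‖poch b k‖ ≤ (1 + ‖b‖ / c) ^ k * ‖poch (c : ℂ) k‖ := by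
    intro k
    induction k with
    | zero => simp [poch_zero]
    | succ k ih =>
      rw [poch_succ, poch_succ, norm_mul, norm_mul, pow_succ]
      have h1 : ‖b + k‖ ≤ (1 + ‖b‖ / c) * ‖(c : ℂ) + k‖ := by
        have h2 : ‖(c : ℂ) + k‖ = c + k := by
          rw [show (c : ℂ) + k = ((c + k : ℝ) : ℂ) by push_cast; rfl, norm_real]
          exact abs_of_pos (by positivity)
        rw [h2]
        calc ‖b + k‖ ≤ ‖b‖ + ‖(k : ℂ)‖ := norm_add_le _ _
          _ = ‖b‖ + k := by rw [norm_natCast]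
          _ ≤ c + k + ‖b‖ / c * (c + k) := by
            have h3 : ‖b‖ / c * (c + k) = ‖b‖ + ‖b‖ / c * k := by field_simp
            have h4 : 0 ≤ ‖b‖ / c * k := by positivity
            linarith
          _ = _ := by ring
      calc _ ≤ (1 + ‖b‖ / c) ^ k * ‖poch (c : ℂ) k‖ * ((1 + ‖b‖ / c) * ‖(c : ℂ) + k‖) :=
            mul_le_mul ih h1 (norm_nonneg _) (by positivity)
        _ = _ := by ring
  have h0 : 0 < ‖poch (c : ℂ) k‖ := norm_pos_iff.2 (poch_ne_zero (by simpa using hc) k)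
  have hf : (0 : ℝ) < k.factorial := by positivity
  rw [kummerCoeff, norm_div, norm_mul, norm_natCast, div_le_div_iff₀ (by positivity) hf]
  nlinarith [hp k]

theorem oneF1_eq_tsum (b c z : ℂ) : oneF1 b c z = ∑' k, kummerCoeff b c k * z ^ k := rfl

/-- The damped hypergeometric polynomial approximating `₁F₁[b, c; ·]`. -/
def dampedF1 (d : ℕ) (b c : ℂ) (n : ℕ) (z : ℂ) : ℂ :=
  ∑ k ∈ Finset.range (n + 1 - d + 1), (damping d n k : ℂ) * kummerCoeff b c k * z ^ k

theorem dampedF1_eq_tsum (d : ℕ) (b c : ℂ) (n : ℕ) (z : ℂ) :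
    dampedF1 d b c n z = ∑' k, (damping d n k : ℂ) * kummerCoeff b c k * z ^ k := by
  rw [tsum_eq_sum, dampedF1]
  intro k hk
  have : (n + 1 - d).descFactorial k = 0 := by
    rw [Nat.descFactorial_eq_zero_iff_lt]
    simpa [Nat.lt_succ_iff] using hk
  simp [damping, this]

theorem differentiable_dampedF1 (d : ℕ) (b c : ℂ) (n : ℕ) :
    Differentiable ℂ (dampedF1 d b c n) := by
  unfold dampedF1; fun_prop

theorem norm_kummerCoeff_mul_pow_le (b : ℂ) {c : ℝ} (hc : 0 < c) {z : ℂ} {M : ℝ} (hz : ‖z‖ ≤ M)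
    (k : ℕ) : ‖kummerCoeff b c k * z ^ k‖ ≤ ((1 + ‖b‖ / c) * M) ^ k / k.factorial := by
  rw [norm_mul, norm_pow, mul_pow, mul_div_right_comm]
  exact mul_le_mul (norm_kummerCoeff_le b hc k) (by gcongr) (by positivity) (by positivity)

theorem tendstoLocallyUniformlyOn_dampedF1 (d : ℕ) (b : ℂ) {c : ℝ} (hc : 0 < c) :
    TendstoLocallyUniformlyOn (dampedF1 d b c) (oneF1 b c) atTop univ := by
  rw [tendstoLocallyUniformlyOn_iff_forall_isCompact isOpen_univ]
  intro K _ hK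
  obtain ⟨M, hM⟩ := hK.isBounded.exists_norm_le
  let g : ℕ → ℝ := fun k => ((1 + ‖b‖ / c) * M) ^ k / k.factorial
  have hg : Summable g := Real.summable_pow_div_factorial _
  have hlim : Tendsto (fun n => ∑' k, (1 - damping d n k) * g k) atTop (nhds (∑' _ : ℕ, 0)) := by
    refine tendsto_tsum_of_dominated_convergence hg.norm (fun k => ?_)
      (Eventually.of_forall fun n k => ?_)
    · have := ((tendsto_damping d k).const_sub 1).mul_const (g k)
      simpa using this
    · rw [norm_mul]
      refine mul_le_of_le_one_left (norm_nonneg _) ?_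
      rw [Real.norm_eq_abs, abs_le]
      constructor <;> linarith [damping_nonneg d n k, damping_le_one d n k]
  rw [tsum_zero] at hlim
  rw [Metric.tendstoUniformlyOn_iff]
  intro ε hε
  filter_upwards [hlim.eventually (gt_mem_nhds hε)] with n hn z hz
  refine lt_of_le_of_lt ?_ hn
  have hs1 : Summable fun k => kummerCoeff b c k * z ^ k :=
    Summable.of_norm_bounded hg fun k => norm_kummerCoeff_mul_pow_le b hc (hM z hz) k
  have hs2 : Summable fun k => (damping d n k : ℂ) * kummerCoeff b c k * z ^ k := by
    refine Summable.of_norm_bounded hg fun k => ?_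
    rw [mul_assoc, norm_mul, norm_real, Real.norm_of_nonneg (damping_nonneg _ _ _)]
    exact (mul_le_of_le_one_left (norm_nonneg _) (damping_le_one _ _ _)).trans
      (norm_kummerCoeff_mul_pow_le b hc (hM z hz) k)
  rw [dist_eq_norm, oneF1_eq_tsum, dampedF1_eq_tsum, ← hs1.tsum_sub hs2]
  have hle : ∀ k, ‖kummerCoeff b c k * z ^ k - (damping d n k : ℂ) * kummerCoeff b c k * z ^ k‖ ≤
      (1 - damping d n k) * g k := by
    intro k
    rw [show kummerCoeff b c k * z ^ k - (damping d n k : ℂ) * kummerCoeff b c k * z ^ k =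
      ((1 - damping d n k : ℝ) : ℂ) * (kummerCoeff b c k * z ^ k) by push_cast; ring, norm_mul,
      norm_real, Real.norm_of_nonneg (by linarith [damping_le_one d n k])]
    exact mul_le_mul_of_nonneg_left (norm_kummerCoeff_mul_pow_le b hc (hM z hz) k)
      (by linarith [damping_le_one d n k])
  refine tsum_of_norm_bounded (Summable.hasSum ?_) hle
  refine Summable.of_norm_bounded hg.norm fun k => ?_
  rw [norm_mul]
  refine mul_le_of_le_one_left (norm_nonneg _) ?_
  rw [Real.norm_eq_abs, abs_le]
  constructor <;> linarith [damping_nonneg d n k, damping_le_one d n k]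

theorem differentiable_oneF1 (b : ℂ) {c : ℝ} (hc : 0 < c) : Differentiable ℂ (oneF1 b c) :=
  differentiableOn_univ.1 ((tendstoLocallyUniformlyOn_dampedF1 0 b hc).differentiableOn
    (Eventually.of_forall fun n => (differentiable_dampedF1 0 b c n).differentiableOn) isOpen_univ)

theorem TendstoLocallyUniformlyOn.tendsto_apply {f : ℕ → ℂ → ℂ} {F : ℂ → ℂ}
    (h : TendstoLocallyUniformlyOn f F atTop univ) {z : ℕ → ℂ} {w : ℂ} (hF : ContinuousAt F w)
    (hz : Tendsto z atTop (nhds w)) : Tendsto (fun n => f n (z n)) atTop (nhds (F w)) := by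
  refine h.tendsto_comp (x := w) ?_ (mem_univ w) ?_
  · rwa [continuousWithinAt_univ]
  · rwa [nhdsWithin_univ]

theorem TendstoLocallyUniformlyOn.eventually_norm_le {f : ℕ → ℂ → ℂ} {F : ℂ → ℂ}
    (h : TendstoLocallyUniformlyOn f F atTop univ) (hF : Continuous F) (M : ℝ) :
    ∃ B, ∀ᶠ n in atTop, ∀ z : ℂ, ‖z‖ ≤ M → ‖f n z‖ ≤ B := by
  have hK : IsCompact (Metric.closedBall (0 : ℂ) M) := isCompact_closedBall _ _
  obtain ⟨B, hB⟩ := hK.exists_bound_of_continuousOn hF.continuousOn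
  have hu := (tendstoLocallyUniformlyOn_iff_forall_isCompact isOpen_univ).1 h _ (subset_univ _) hK
  refine ⟨B + 1, ?_⟩
  filter_upwards [Metric.tendstoUniformlyOn_iff.1 hu 1 one_pos] with n hn z hz
  have hz' : z ∈ Metric.closedBall (0 : ℂ) M := by simpa using hz
  have h1 := hn z hz'
  rw [dist_comm, dist_eq_norm] at h1
  calc ‖f n z‖ = ‖F z + (f n z - F z)‖ := by ring_nf
    _ ≤ ‖F z‖ + ‖f n z - F z‖ := norm_add_le _ _
    _ ≤ B + 1 := add_le_add (hB z hz') h1.le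

/-- The constant `C_{N,s} / (4 N^{2 Re s + 1})` for `N = n + 1`. -/
def scaledConst (s : ℂ) (n : ℕ) : ℂ :=
  CNs s (n + 1) / (4 * ((n + 1 : ℕ) : ℂ) ^ ((2 * s.re + 1 : ℝ) : ℂ))

/-- The limit of `scaledConst`. -/
def limitConst (s : ℂ) : ℂ := cinf s * (((2 : ℝ) ^ (2 * s.re) : ℝ) : ℂ) / 2

theorem tendsto_scaledConst {s : ℂ} (hs : -(1 / 2 : ℝ) < s.re) :
    Tendsto (scaledConst s) atTop (nhds (limitConst s)) := by
  set a : ℂ := ((2 * s.re + 1 : ℝ) : ℂ) with ha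
  have hare : 0 < a.re := by rw [ha, ofReal_re]; linarith
  have ha0 : a ≠ 0 := by intro h; rw [h] at hare; simp at hare
  have hGa := Gamma_ne_zero_of_re_pos hare
  set K : ℂ := (((2 : ℝ) ^ (2 * s.re) : ℝ) : ℂ) / (4 * Real.pi) *
    (Gamma (s + 1) * Gamma ((starRingEnd ℂ) s + 1)) / Gamma ((2 * s.re + 2 : ℝ) : ℂ) with hK
  have h1 : Tendsto (fun n : ℕ => (GammaSeq a n)⁻¹ * ((n : ℂ) / ((n + 1 : ℕ) : ℂ)) ^ a) atTop
      (nhds ((Gamma a)⁻¹ * 1 ^ a)) := by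
    refine ((GammaSeq_tendsto_Gamma a).inv₀ hGa).mul ?_
    have h2 : Tendsto (fun n : ℕ => (n : ℂ) / ((n + 1 : ℕ) : ℂ)) atTop (nhds 1) := by
      have := tendsto_natCast_div_add_atTop (𝕜 := ℂ) 1
      simpa using this
    exact (continuousAt_cpow_const (by simp)).tendsto.comp h2
  rw [one_cpow, mul_one] at h1
  have h3 := h1.const_mul K
  have hlim : K * (Gamma a)⁻¹ = limitConst s := by
    rw [limitConst, cinf, hK, ← ha]
    ring
  rw [hlim] at h3
  refine h3.congr' ?_
  filter_upwards [eventually_ge_atTop 1] with n hn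
  have hn0 : (n : ℂ) ≠ 0 := by exact_mod_cast (by omega : n ≠ 0)
  have e5 : ((2 * s.re + (n + 1 : ℕ) + 1 : ℝ) : ℂ) = a + ((n + 1 : ℕ) : ℂ) := by
    rw [ha]; push_cast; ring
  have hdiv : ((n : ℂ) / ((n + 1 : ℕ) : ℂ)) ^ a = (n : ℂ) ^ a / ((n + 1 : ℕ) : ℂ) ^ a := by
    have := Complex.div_cpow_ofReal_nonneg n.cast_nonneg (n + 1).cast_nonneg a
    simpa only [ofReal_natCast] using this
  have hseq : GammaSeq a n = (n : ℂ) ^ a * n.factorial / poch a (n + 1) := rfl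
  have hna : (n : ℂ) ^ a ≠ 0 := by rw [Ne, cpow_eq_zero_iff]; tauto
  have hna1 : (((n + 1 : ℕ) : ℂ)) ^ a ≠ 0 := by
    rw [Ne, cpow_eq_zero_iff]; push Not; intro h; exact absurd h (by exact_mod_cast n.succ_ne_zero)
  have hf : Gamma ((n + 1 : ℕ) : ℂ) = n.factorial := by push_cast; exact Gamma_nat_eq_factorial n
  have hf0 : (n.factorial : ℂ) ≠ 0 := by exact_mod_cast n.factorial_ne_zero
  have hpi : (Real.pi : ℂ) ≠ 0 := ofReal_ne_zero.2 Real.pi_ne_zero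
  have hp := poch_ne_zero hare (n + 1)
  rw [scaledConst, CNs, e5, Gamma_add_nat_eq_poch_mul hare, hf, hdiv, hseq, hK, ofReal_div, ← ha]
  generalize (((2 : ℝ) ^ (2 * s.re) : ℝ) : ℂ) = T at *
  generalize Gamma ((2 * s.re + 2 : ℝ) : ℂ) = G2 at *
  field_simp

/-- The rescaled factor `N^{Re s} √w(Nx) (Nx - i)^N` for `N = n + 1`. -/
def scaledFactor (s : ℂ) (n : ℕ) (x : ℝ) : ℂ :=
  ((((n + 1 : ℕ) : ℝ) ^ s.re * √(wH s (n + 1) (((n + 1 : ℕ) : ℝ) * x)) : ℝ) : ℂ) *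
    ((((n + 1 : ℕ) : ℝ) * x : ℝ) - I) ^ (n + 1)

theorem norm_ofReal_sub_I (x : ℝ) : ‖(x : ℂ) - I‖ = (1 + x ^ 2) ^ (1 / 2 : ℝ) := by
  rw [← norm_one_add_I_mul, show (x : ℂ) - I = -I * (1 + I * x) by
    linear_combination (x : ℂ) * I_sq, norm_mul]
  simp

theorem norm_scaledFactor (s : ℂ) (n : ℕ) (x : ℝ) :
    ‖scaledFactor s n x‖ = (1 / ((n + 1 : ℕ) : ℝ) ^ 2 + x ^ 2) ^ (-s.re / 2) *
      Real.exp (s.im * arg (((1 / ((n + 1 : ℕ) : ℝ) : ℝ) : ℂ) + I * x)) := by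
  set N : ℝ := ((n + 1 : ℕ) : ℝ) with hN
  have hNpos : 0 < N := by rw [hN]; positivity
  have hb : 0 < 1 + (N * x) ^ 2 := by positivity
  have h1 : √(wH s (n + 1) (N * x)) = (1 + (N * x) ^ 2) ^ ((-s.re - N) / 2) *
      Real.exp (s.im * arg (1 + I * (N * x : ℝ))) := by
    rw [wH, ← hN, Real.sqrt_mul (by positivity), Real.sqrt_eq_rpow, ← Real.rpow_mul hb.le,
      Real.sqrt_eq_rpow, ← Real.exp_mul]
    congr 2
    · ring
    · ring
  have h2 : arg (1 + I * (N * x : ℝ)) = arg (((1 / N : ℝ) : ℂ) + I * x) := by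
    rw [← Complex.arg_real_mul (((1 / N : ℝ) : ℂ) + I * x) hNpos]
    congr 1
    have : (N : ℂ) ≠ 0 := ofReal_ne_zero.2 hNpos.ne'
    push_cast
    field_simp
  have h3 : 1 / N ^ 2 + x ^ 2 = (1 + (N * x) ^ 2) * (N ^ 2)⁻¹ := by field_simp
  have h4 : (N ^ 2)⁻¹ ^ (-s.re / 2) = N ^ s.re := by
    rw [Real.inv_rpow (by positivity), ← Real.rpow_neg (by positivity), ← Real.rpow_natCast,
      ← Real.rpow_mul hNpos.le]
    congr 1
    push_cast
    ring
  rw [scaledFactor, norm_mul, norm_pow, norm_real, norm_ofReal_sub_I, ← hN,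
    Real.norm_of_nonneg (by positivity), h1, h2, h3, Real.mul_rpow hb.le (by positivity), h4,
    ← Real.rpow_mul_natCast hb.le]
  have h5 : (1 + (N * x) ^ 2) ^ (-s.re / 2) = (1 + (N * x) ^ 2) ^ ((-s.re - N) / 2) *
      (1 + (N * x) ^ 2) ^ (1 / 2 * ((n + 1 : ℕ) : ℝ)) := by
    rw [← Real.rpow_add hb]
    congr 1
    rw [← hN]
    ring
  rw [h5]
  ring

theorem norm_scaledFactor_sq_le (s : ℂ) {x₀ : ℝ} (hx₀ : 0 < x₀) (n : ℕ) {x : ℝ} (hx : x₀ < x) :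
    ‖scaledFactor s n x‖ ^ 2 ≤
      (1 + 1 / x₀ ^ 2) ^ |s.re| * Real.exp (2 * (|s.im| * Real.pi)) * x ^ (-2 * s.re) := by
  have hx' : 0 < x := hx₀.trans hx
  set N : ℝ := ((n + 1 : ℕ) : ℝ) with hN
  have hN1 : 1 ≤ N := by rw [hN]; exact_mod_cast Nat.succ_pos n
  have h1 : 1 / N ^ 2 + x ^ 2 = x ^ 2 * (1 + 1 / (N * x) ^ 2) := by
    field_simp
    ring
  rw [norm_scaledFactor, ← hN, mul_pow, ← Real.rpow_mul_natCast (by positivity), ← Real.exp_nat_mul,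
    h1, Real.mul_rpow (by positivity) (by positivity), ← Real.rpow_natCast x 2,
    ← Real.rpow_mul hx'.le]
  have e1 : ((2 : ℕ) : ℝ) * (-s.re / 2 * (2 : ℕ)) = -2 * s.re := by push_cast; ring
  have e2 : -s.re / 2 * ((2 : ℕ) : ℝ) = -s.re := by push_cast; ring
  rw [e1, e2]
  have h2 : (1 + 1 / (N * x) ^ 2) ^ (-s.re) ≤ (1 + 1 / x₀ ^ 2) ^ |s.re| := by
    have h3 : 1 + 1 / (N * x) ^ 2 ≤ 1 + 1 / x₀ ^ 2 := by
      have : x₀ ≤ N * x := by nlinarith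
      gcongr
    calc _ ≤ (1 + 1 / (N * x) ^ 2) ^ |s.re| :=
          Real.rpow_le_rpow_of_exponent_le (by simp; positivity) (neg_le_abs _)
      _ ≤ _ := Real.rpow_le_rpow (by positivity) h3 (abs_nonneg _)
  have h4 : Real.exp (((2 : ℕ) : ℝ) * (s.im * arg (((1 / N : ℝ) : ℂ) + I * x))) ≤
      Real.exp (2 * (|s.im| * Real.pi)) := by
    refine Real.exp_le_exp.2 ?_
    push_cast
    have := abs_arg_le_pi (((1 / N : ℝ) : ℂ) + I * x)
    have h5 : s.im * arg (((1 / N : ℝ) : ℂ) + I * x) ≤ |s.im| * Real.pi := by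
      refine (le_abs_self _).trans ?_
      rw [abs_mul]
      gcongr
    push_cast at h5
    linarith
  have h6 : 0 ≤ x ^ (-2 * s.re) := by positivity
  calc x ^ (-2 * s.re) * (1 + 1 / (N * x) ^ 2) ^ (-s.re) * _ ≤
      x ^ (-2 * s.re) * (1 + 1 / x₀ ^ 2) ^ |s.re| * Real.exp (2 * (|s.im| * Real.pi)) := by
        gcongr
    _ = _ := by ring

/-- The limit of `scaledFactor`. -/
def limitFactor (s : ℂ) (x : ℝ) : ℂ :=
  ((x ^ (-s.re) * Real.exp (s.im * (Real.pi / 2)) : ℝ) : ℂ) * cexp (-I / x)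

theorem prefac_of_pos (s : ℂ) {x : ℝ} (hx : 0 < x) :
    prefac s x = (((2 : ℝ) ^ s.re : ℝ) : ℂ) * limitFactor s x := by
  rw [prefac, limitFactor, abs_of_pos (by positivity), Real.sign_of_pos hx, Complex.exp_add,
    Real.div_rpow (by norm_num) hx.le, Real.rpow_neg hx.le, ← ofReal_exp,
    show Real.pi * s.im * 1 / 2 = s.im * (Real.pi / 2) by ring]
  push_cast
  ring

theorem tendsto_norm_scaledFactor (s : ℂ) {x : ℝ} (hx : 0 < x) :
    Tendsto (fun n => ‖scaledFactor s n x‖) atTop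
      (nhds (x ^ (-s.re) * Real.exp (s.im * (Real.pi / 2)))) := by
  simp only [norm_scaledFactor]
  have h0 : Tendsto (fun n : ℕ => 1 / ((n + 1 : ℕ) : ℝ)) atTop (nhds 0) := by
    simpa using tendsto_one_div_add_atTop_nhds_zero_nat (𝕜 := ℝ)
  refine Tendsto.mul ?_ ?_
  · have h1 : Tendsto (fun n : ℕ => 1 / ((n + 1 : ℕ) : ℝ) ^ 2 + x ^ 2) atTop
        (nhds (0 ^ 2 + x ^ 2)) := by
      refine Tendsto.add_const _ ((h0.pow 2).congr fun n => ?_)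
      rw [div_pow, one_pow]
    have h2 := h1.rpow_const (p := -s.re / 2) (Or.inl (by positivity))
    have h3 : (0 ^ 2 + x ^ 2) ^ (-s.re / 2) = x ^ (-s.re) := by
      rw [zero_pow two_ne_zero, zero_add, ← Real.rpow_natCast, ← Real.rpow_mul hx.le]
      congr 1
      push_cast
      ring
    rwa [h3] at h2
  · have h1 : Tendsto (fun n : ℕ => ((1 / ((n + 1 : ℕ) : ℝ) : ℝ) : ℂ) + I * x) atTop
        (nhds ((0 : ℝ) + I * x)) := ((continuous_ofReal.tendsto 0).comp h0).add_const _
    have hI : ((0 : ℝ) : ℂ) + I * x = x * I := by simp [mul_comm]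
    rw [hI] at h1
    have hmem : (x : ℂ) * I ∈ slitPlane := Or.inr (by simpa using hx.ne')
    have h2 := (continuousAt_arg hmem).tendsto.comp h1
    have h3 : arg ((x : ℂ) * I) = Real.pi / 2 := by
      rw [Complex.arg_real_mul _ hx, arg_I]
    rw [h3] at h2
    exact (Real.continuous_exp.tendsto _).comp (h2.const_mul _)

theorem tendsto_scaledFactor (s : ℂ) {x : ℝ} (hx : 0 < x) :
    Tendsto (fun n => scaledFactor s n x) atTop (nhds (limitFactor s x)) := by
  have hxC : (x : ℂ) ≠ 0 := ofReal_ne_zero.2 hx.ne'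
  have h1 : Tendsto (fun n : ℕ => (1 + (-I / x) / ((n + 1 : ℕ) : ℂ)) ^ (n + 1)) atTop
      (nhds (cexp (-I / x))) :=
    (Complex.tendsto_one_add_div_pow_exp (-I / x)).comp (tendsto_add_atTop_nat 1)
  have hnorm : ‖cexp (-I / x)‖ = 1 := by
    rw [Complex.norm_exp]
    simp [div_re]
  have h2 := h1.norm
  rw [hnorm] at h2
  have h3 := (continuous_ofReal.tendsto _).comp (tendsto_norm_scaledFactor s hx)
  have h4 := h3.mul (h1.div ((continuous_ofReal.tendsto _).comp h2) (by simp))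
  rw [ofReal_one, div_one] at h4
  refine h4.congr fun n => ?_
  simp only [Function.comp_apply, Pi.div_apply]
  set N : ℝ := ((n + 1 : ℕ) : ℝ) with hN
  have hNpos : 0 < N := by rw [hN]; positivity
  have hNC : (N : ℂ) ≠ 0 := ofReal_ne_zero.2 hNpos.ne'
  have hcast : ((n + 1 : ℕ) : ℂ) = (N : ℂ) := by rw [hN]; push_cast; rfl
  have hω : ((N * x : ℝ) : ℂ) - I = ((N * x : ℝ) : ℂ) * (1 + (-I / x) / N) := by
    push_cast
    field_simp
    ring
  set ω : ℂ := 1 + (-I / x) / N with hωdef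
  have hω0 : ω ≠ 0 := by
    intro h
    rw [h, mul_zero] at hω
    have := congrArg im hω
    simp at this
  have hωn : ((‖ω‖ : ℝ) : ℂ) ≠ 0 := ofReal_ne_zero.2 (norm_ne_zero_iff.2 hω0)
  simp only [hcast, ← hωdef]
  rw [scaledFactor, ← hN, hω, norm_mul _ (_ ^ _), norm_real, norm_pow, norm_pow, norm_mul _ ω,
    norm_real, Real.norm_of_nonneg (by positivity), Real.norm_of_nonneg (by positivity)]
  push_cast
  field_simp
  ring_nf

/-- The difference quotient `(f(z) g(w) - g(z) f(w)) / (z - w)`, extended by the Wronskian. -/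
def bezoutQuot (f g : ℂ → ℂ) (z w : ℂ) : ℂ := dslope f w z * g w - dslope g w z * f w

theorem bezoutQuot_self (f g : ℂ → ℂ) (z : ℂ) :
    bezoutQuot f g z z = deriv f z * g z - deriv g z * f z := by
  rw [bezoutQuot, dslope_same, dslope_same]

theorem bezoutQuot_of_ne (f g : ℂ → ℂ) {z w : ℂ} (h : z ≠ w) :
    bezoutQuot f g z w = (f z * g w - g z * f w) / (z - w) := by
  have h0 : z - w ≠ 0 := sub_ne_zero.2 h
  rw [bezoutQuot, dslope_of_ne _ h, dslope_of_ne _ h, slope_def_field, slope_def_field]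
  field_simp
  ring

/-- The point `-2N / (1 + iNx)`, `N = n + 1`, approximating `2i/x`. -/
def cayleyPoint (n : ℕ) (x : ℝ) : ℂ :=
  -2 * ((n + 1 : ℕ) : ℂ) / (1 + I * ((((n + 1 : ℕ) : ℝ) * x : ℝ) : ℂ))

theorem cayleyPoint_sub (n : ℕ) (x y : ℝ) :
    cayleyPoint n x - cayleyPoint n y = I / 2 * (cayleyPoint n x * cayleyPoint n y) * (x - y) := by
  have hx := one_add_I_mul_ne_zero (((n + 1 : ℕ) : ℝ) * x)
  have hy := one_add_I_mul_ne_zero (((n + 1 : ℕ) : ℝ) * y)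
  have h : I * ((n + 1 : ℕ) : ℂ) * (x - y) = (1 + I * ((((n + 1 : ℕ) : ℝ) * x : ℝ) : ℂ)) -
      (1 + I * ((((n + 1 : ℕ) : ℝ) * y : ℝ) : ℂ)) := by push_cast; ring
  rw [cayleyPoint, cayleyPoint]
  generalize 1 + I * ((((n + 1 : ℕ) : ℝ) * x : ℝ) : ℂ) = A at *
  generalize 1 + I * ((((n + 1 : ℕ) : ℝ) * y : ℝ) : ℂ) = B at *
  field_simp
  linear_combination (-1 : ℂ) * h

theorem cayleyPoint_ne_zero (n : ℕ) (x : ℝ) : cayleyPoint n x ≠ 0 :=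
  div_ne_zero (mul_ne_zero (by norm_num) (by exact_mod_cast n.succ_ne_zero))
    (one_add_I_mul_ne_zero _)

theorem cayleyPoint_ne (n : ℕ) {x y : ℝ} (h : x ≠ y) : cayleyPoint n x ≠ cayleyPoint n y := by
  have h0 : (x : ℂ) - y ≠ 0 := sub_ne_zero.2 (by exact_mod_cast h)
  rw [← sub_ne_zero, cayleyPoint_sub]
  exact mul_ne_zero (mul_ne_zero (by simp) (mul_ne_zero (cayleyPoint_ne_zero n x)
    (cayleyPoint_ne_zero n y))) h0

theorem continuous_cayleyPoint (n : ℕ) : Continuous (cayleyPoint n) := by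
  unfold cayleyPoint
  exact continuous_const.div (by fun_prop) fun x => one_add_I_mul_ne_zero _

theorem norm_cayleyPoint_le (n : ℕ) {x : ℝ} (hx : 0 < x) : ‖cayleyPoint n x‖ ≤ 2 / x := by
  have h1 : ((n + 1 : ℕ) : ℝ) * x ≤ ‖1 + I * ((((n + 1 : ℕ) : ℝ) * x : ℝ) : ℂ)‖ := by
    refine le_trans (le_of_eq ?_) (abs_im_le_norm _)
    have : 0 ≤ ((n + 1 : ℕ) : ℝ) * x := by positivity
    simp only [add_im, one_im, mul_im, I_re, I_im, ofReal_re, ofReal_im]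
    rw [mul_zero, one_mul, zero_add, zero_add, abs_of_nonneg this]
  rw [cayleyPoint, norm_div, norm_mul, norm_natCast, norm_neg, RCLike.norm_ofNat]
  have hN : (0 : ℝ) < ((n + 1 : ℕ) : ℝ) := by positivity
  calc _ ≤ 2 * ((n + 1 : ℕ) : ℝ) / (((n + 1 : ℕ) : ℝ) * x) := by gcongr
    _ = 2 / x := by field_simp

theorem tendsto_cayleyPoint {x : ℝ} (hx : 0 < x) :
    Tendsto (fun n => cayleyPoint n x) atTop (nhds (2 * I / x)) := by
  have hxC : (x : ℂ) ≠ 0 := ofReal_ne_zero.2 hx.ne'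
  have h0 : Tendsto (fun n : ℕ => 1 / ((n + 1 : ℕ) : ℂ)) atTop (nhds 0) := by
    simpa using tendsto_one_div_add_atTop_nhds_zero_nat (𝕜 := ℂ)
  have h1 : Tendsto (fun n : ℕ => -2 / (1 / ((n + 1 : ℕ) : ℂ) + I * x)) atTop
      (nhds (-2 / (0 + I * x))) :=
    tendsto_const_nhds.div (h0.add_const _) (by simpa using hxC)
  have h2 : -2 / (0 + I * (x : ℂ)) = 2 * I / x := by
    field_simp
    rw [zero_add]
    field_simp
    rw [I_sq]
  rw [h2] at h1
  refine h1.congr fun n => ?_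
  have hN : ((n + 1 : ℕ) : ℂ) ≠ 0 := by exact_mod_cast n.succ_ne_zero
  have hx := one_add_I_mul_ne_zero (((n + 1 : ℕ) : ℝ) * x)
  rw [cayleyPoint]
  rw [ofReal_mul, ofReal_natCast] at *
  have e : 1 / ((n + 1 : ℕ) : ℂ) + I * x = (1 + I * (((n + 1 : ℕ) : ℂ) * x)) / ((n + 1 : ℕ) : ℂ) := by
    field_simp
  rw [e]
  field_simp

theorem eval_hyperPoly_eq_dampedF1 {d n m : ℕ} (hm : n + 1 - d = m) (b c : ℂ) (x : ℝ) :
    (hyperPoly m b c).eval ((((n + 1 : ℕ) : ℝ) * x : ℝ) : ℂ) =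
      (((((n + 1 : ℕ) : ℝ) * x : ℝ) : ℂ) - I) ^ m * dampedF1 d b c n (cayleyPoint n x) := by
  have hA := one_add_I_mul_ne_zero (((n + 1 : ℕ) : ℝ) * x)
  rw [eval_hyperPoly, dampedF1, hm, Finset.mul_sum, cayleyPoint]
  have hN : ((n + 1 : ℕ) : ℂ) ≠ 0 := by exact_mod_cast n.succ_ne_zero
  set X : ℂ := ((((n + 1 : ℕ) : ℝ) * x : ℝ) : ℂ) with hX
  refine Finset.sum_congr rfl fun k hk => ?_
  have hk' : k ≤ m := by simpa [Nat.lt_succ_iff] using hk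
  rw [show X - I = -I * (1 + I * X) by linear_combination X * I_sq, mul_pow (-I),
    pow_sub₀ _ hA hk', poch_neg_nat_eq, damping, hm, kummerCoeff, div_pow, mul_pow,
    show ((-2 : ℂ)) ^ k = (-1) ^ k * 2 ^ k by rw [← mul_pow]; norm_num]
  push_cast at *
  field_simp

theorem eval_polyQ (s : ℂ) (n : ℕ) (x : ℝ) :
    (polyQ s n).eval ((((n + 1 : ℕ) : ℝ) * x : ℝ) : ℂ) =
      (((((n + 1 : ℕ) : ℝ) * x : ℝ) : ℂ) - I) ^ (n + 1) *
        dampedF1 0 s ((2 * s.re + 1 : ℝ) : ℂ) n (cayleyPoint n x) :=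
by
  rw [polyQ, eval_hyperPoly_eq_dampedF1 (d := 0) (n := n) (m := n + 1) (by omega)]

theorem eval_polyP (s : ℂ) (n : ℕ) (x : ℝ) :
    2 * I * ((n + 1 : ℕ) : ℂ) * (polyP s n).eval ((((n + 1 : ℕ) : ℝ) * x : ℝ) : ℂ) =
      (((((n + 1 : ℕ) : ℝ) * x : ℝ) : ℂ) - I) ^ (n + 1) * (cayleyPoint n x *
        dampedF1 1 (s + 1) ((2 * s.re + 2 : ℝ) : ℂ) n (cayleyPoint n x)) := by
  have hA := one_add_I_mul_ne_zero (((n + 1 : ℕ) : ℝ) * x)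
  have h : ((((n + 1 : ℕ) : ℝ) * x : ℝ) - I) * cayleyPoint n x = 2 * I * ((n + 1 : ℕ) : ℂ) := by
    rw [cayleyPoint]
    set X : ℂ := ((((n + 1 : ℕ) : ℝ) * x : ℝ) : ℂ) with hX
    rw [show X - I = -I * (1 + I * X) by linear_combination X * I_sq]
    field_simp
  rw [polyP, eval_hyperPoly_eq_dampedF1 (d := 1) (n := n) (m := n) (by omega)]
  rw [mul_comm, ← h]
  ring

/-- The numerator function `₁F₁[s, 2 Re s + 1; ·]`, damped. -/
def dampedNum (s : ℂ) (n : ℕ) : ℂ → ℂ := dampedF1 0 s ((2 * s.re + 1 : ℝ) : ℂ) n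

/-- The function `z ₁F₁[s + 1, 2 Re s + 2; z]`, damped. -/
def dampedDen (s : ℂ) (n : ℕ) (z : ℂ) : ℂ :=
  z * dampedF1 1 (s + 1) ((2 * s.re + 2 : ℝ) : ℂ) n z

theorem differentiable_dampedNum (s : ℂ) (n : ℕ) : Differentiable ℂ (dampedNum s n) :=
  differentiable_dampedF1 _ _ _ _

theorem differentiable_dampedDen (s : ℂ) (n : ℕ) : Differentiable ℂ (dampedDen s n) :=
  differentiable_id.mul (differentiable_dampedF1 _ _ _ _)

theorem continuous_scaledKernel (s : ℂ) (N : ℕ) :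
    Continuous fun p : ℝ × ℝ => scaledKernel s N p.1 p.2 := by
  have h := continuous_wH s N
  unfold scaledKernel weightedMonomial
  fun_prop

theorem ofReal_scaledKernel {s : ℂ} (hs : -(1 / 2 : ℝ) < s.re) (n : ℕ) (x y : ℝ) :
    (scaledKernel s (n + 1) x y : ℂ) = ((n + 1 : ℕ) : ℂ) *
      (√(wH s (n + 1) (((n + 1 : ℕ) : ℝ) * x)) * √(wH s (n + 1) (((n + 1 : ℕ) : ℝ) * y))) *
      CNs s (n + 1) * ∑ i ∈ Finset.range (n + 1), ∑ j ∈ Finset.range (n + 1),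
        bezoutCoeff (polyP s n).coeff (polyQ s n).coeff i j *
          ((((n + 1 : ℕ) : ℝ) * x : ℝ) : ℂ) ^ i * ((((n + 1 : ℕ) : ℝ) * y : ℝ) : ℂ) ^ j := by
  have hN : ((√((n + 1 : ℕ) : ℝ) : ℝ) : ℂ) * ((√((n + 1 : ℕ) : ℝ) : ℝ) : ℂ) = ((n + 1 : ℕ) : ℂ) := by
    rw [← ofReal_mul, Real.mul_self_sqrt (by positivity), ofReal_natCast]
  rw [scaledKernel, ofReal_sum, Finset.mul_sum, ← Fin.sum_univ_eq_sum_range (fun i => _ * _)]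
  refine Finset.sum_congr rfl fun i _ => ?_
  rw [Finset.mul_sum, ofReal_sum, Finset.mul_sum, ← Fin.sum_univ_eq_sum_range (fun i => _ * _)]
  refine Finset.sum_congr rfl fun j _ => ?_
  rw [← hN, weightedMonomial, weightedMonomial, ofReal_mul, ofReal_mul, ofReal_mul, ofReal_mul,
    ofReal_mul, ofReal_mul, ofReal_hankel_inv hs, ofReal_pow, ofReal_pow]
  ring

theorem sum_coeff_mul_pow_eq_eval {p : Polynomial ℂ} {N : ℕ} (h : p.natDegree ≤ N) (z : ℂ) :
    ∑ i ∈ Finset.range (N + 1), p.coeff i * z ^ i = p.eval z :=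
  (Polynomial.eval_eq_sum_range' (Nat.lt_succ_of_le h) z).symm

theorem scaledKernel_of_ne {s : ℂ} (hs : -(1 / 2 : ℝ) < s.re) (n : ℕ) {x y : ℝ} (hxy : x ≠ y) :
    (scaledKernel s (n + 1) x y : ℂ) = scaledConst s n * (scaledFactor s n x * scaledFactor s n y) *
      (cayleyPoint n x * cayleyPoint n y) *
        bezoutQuot (dampedNum s n) (dampedDen s n) (cayleyPoint n x) (cayleyPoint n y) := by
  have hN : ((n + 1 : ℕ) : ℂ) ≠ 0 := by exact_mod_cast n.succ_ne_zero
  have hP : (polyP s n).natDegree ≤ n + 1 := (natDegree_hyperPoly_le _ _ _).trans n.le_succ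
  have hQ : (polyQ s n).natDegree ≤ n + 1 := natDegree_hyperPoly_le _ _ _
  have hbez := sub_mul_sum_bezoutCoeff (N := n + 1) (p := (polyP s n).coeff)
    (q := (polyQ s n).coeff)
    (fun i hi => Polynomial.coeff_eq_zero_of_natDegree_lt (hP.trans_lt hi))
    (fun i hi => Polynomial.coeff_eq_zero_of_natDegree_lt (hQ.trans_lt hi))
    ((((n + 1 : ℕ) : ℝ) * x : ℝ) : ℂ) ((((n + 1 : ℕ) : ℝ) * y : ℝ) : ℂ)
  simp only [sum_coeff_mul_pow_eq_eval hP, sum_coeff_mul_pow_eq_eval hQ] at hbez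
  have hpx := eval_polyP s n x
  have hpy := eval_polyP s n y
  rw [eval_polyQ, eval_polyQ] at hbez
  rw [ofReal_scaledKernel hs, bezoutQuot_of_ne _ _ (cayleyPoint_ne n hxy), cayleyPoint_sub,
    scaledConst, scaledFactor, scaledFactor]
  have hpow : (((n + 1 : ℕ) : ℂ)) ^ ((2 * s.re + 1 : ℝ) : ℂ) =
      ((n + 1 : ℕ) : ℂ) * (((((n + 1 : ℕ) : ℝ) ^ s.re : ℝ) : ℂ) *
        ((((n + 1 : ℕ) : ℝ) ^ s.re : ℝ) : ℂ)) := by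
    have : (0 : ℝ) < ((n + 1 : ℕ) : ℝ) := by positivity
    rw [← ofReal_natCast, ← ofReal_cpow this.le, ← ofReal_mul, ← ofReal_mul,
      ← Real.rpow_add this,
      show 2 * s.re + 1 = 1 + (s.re + s.re) by ring, Real.rpow_add this, Real.rpow_one]
  have hr : ((((n + 1 : ℕ) : ℝ) ^ s.re : ℝ) : ℂ) ≠ 0 :=
    ofReal_ne_zero.2 (by positivity)
  rw [hpow, ofReal_mul _ (√_), ofReal_mul _ (√_)]
  change _ = _ * ((dampedNum s n _ * (_ * _) - (_ * _) * dampedNum s n _) / _)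
  change (_ : ℂ) * _ = _ * (dampedNum s n _) * _ - _ * (_ * dampedNum s n _) at hbez
  have hζ := cayleyPoint_ne_zero n x
  have hη := cayleyPoint_ne_zero n y
  have hxyC : (x : ℂ) - y ≠ 0 := sub_ne_zero.2 (by exact_mod_cast hxy)
  rw [ofReal_mul _ x, ofReal_mul _ y] at *
  rw [ofReal_natCast] at *
  generalize (∑ i ∈ Finset.range (n + 1), ∑ j ∈ Finset.range (n + 1), (_ : ℂ)) = S at *
  generalize (polyP s n).eval _ = px at *
  generalize (polyP s n).eval _ = py at *
  generalize dampedNum s n (cayleyPoint n x) = F at *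
  generalize dampedNum s n (cayleyPoint n y) = F' at *
  generalize dampedF1 1 _ _ n (cayleyPoint n x) = G at *
  generalize dampedF1 1 _ _ n (cayleyPoint n y) = G' at *
  generalize cayleyPoint n x = ζ at *
  generalize cayleyPoint n y = η at *
  generalize (((n + 1 : ℕ) : ℂ) * x - I) ^ (n + 1) = U at *
  generalize (((n + 1 : ℕ) : ℂ) * y - I) ^ (n + 1) = V at *
  generalize ((n + 1 : ℕ) : ℂ) = N at *
  have hS : S = U * V * (F * (η * G') - ζ * G * F') / (2 * I * N ^ 2 * (x - y)) := by
    rw [eq_div_iff (by simp [hN, hxyC])]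
    linear_combination 2 * I * N * hbez + U * F * hpy - V * F' * hpx
  rw [hS]
  field_simp
  ring

theorem scaledKernel_eq {s : ℂ} (hs : -(1 / 2 : ℝ) < s.re) (n : ℕ) (x y : ℝ) :
    (scaledKernel s (n + 1) x y : ℂ) = scaledConst s n * (scaledFactor s n x * scaledFactor s n y) *
      (cayleyPoint n x * cayleyPoint n y) *
        bezoutQuot (dampedNum s n) (dampedDen s n) (cayleyPoint n x) (cayleyPoint n y) := by
  rcases ne_or_eq x y with hxy | rfl
  · exact scaledKernel_of_ne hs n hxy
  have hne : (nhdsWithin x {x}ᶜ).NeBot := inferInstance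
  have h1 : Tendsto (fun t : ℝ => (scaledKernel s (n + 1) t x : ℂ)) (nhdsWithin x {x}ᶜ)
      (nhds (scaledKernel s (n + 1) x x : ℂ)) := by
    have : Continuous fun t : ℝ => (scaledKernel s (n + 1) t x : ℂ) :=
      continuous_ofReal.comp ((continuous_scaledKernel s (n + 1)).comp
        (continuous_id.prodMk continuous_const))
    exact this.continuousAt.tendsto.mono_left nhdsWithin_le_nhds
  suffices h2 : ContinuousAt (fun t => scaledConst s n * (scaledFactor s n t * scaledFactor s n x) *
      (cayleyPoint n t * cayleyPoint n x) *
        bezoutQuot (dampedNum s n) (dampedDen s n) (cayleyPoint n t) (cayleyPoint n x)) x by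
    refine tendsto_nhds_unique (h1.congr' ?_) (h2.tendsto.mono_left nhdsWithin_le_nhds)
    filter_upwards [self_mem_nhdsWithin] with t ht
    exact scaledKernel_of_ne hs n ht
  · have h2 : Continuous (scaledFactor s n) := by
      have h := continuous_wH s (n + 1)
      unfold scaledFactor
      fun_prop
    have h3 := continuous_cayleyPoint n
    have h4 : ContinuousAt (fun t => dslope (dampedNum s n) (cayleyPoint n x) (cayleyPoint n t))
        x := ContinuousAt.comp (g := dslope (dampedNum s n) (cayleyPoint n x))
      (continuousAt_dslope_same.2 (differentiable_dampedNum s n _)) h3.continuousAt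
    have h5 : ContinuousAt (fun t => dslope (dampedDen s n) (cayleyPoint n x) (cayleyPoint n t))
        x := ContinuousAt.comp (g := dslope (dampedDen s n) (cayleyPoint n x))
      (continuousAt_dslope_same.2 (differentiable_dampedDen s n _)) h3.continuousAt
    have h2' := h2.continuousAt (x := x)
    have h3' := h3.continuousAt (x := x)
    unfold bezoutQuot
    fun_prop

/-- The numerator function `₁F₁[s, 2 Re s + 1; ·]`. -/
def limitNum (s : ℂ) : ℂ → ℂ := oneF1 s ((2 * s.re + 1 : ℝ) : ℂ)

/-- The function `z ₁F₁[s + 1, 2 Re s + 2; z]`. -/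
def limitDen (s z : ℂ) : ℂ := z * oneF1 (s + 1) ((2 * s.re + 2 : ℝ) : ℂ) z

theorem differentiable_limitNum {s : ℂ} (hs : -(1 / 2 : ℝ) < s.re) :
    Differentiable ℂ (limitNum s) :=
  differentiable_oneF1 s (by linarith)

theorem differentiable_limitDen {s : ℂ} (hs : -(1 / 2 : ℝ) < s.re) :
    Differentiable ℂ (limitDen s) :=
  differentiable_id.mul (differentiable_oneF1 (s + 1) (by linarith))

theorem tendstoLocallyUniformlyOn_dampedNum {s : ℂ} (hs : -(1 / 2 : ℝ) < s.re) :
    TendstoLocallyUniformlyOn (dampedNum s) (limitNum s) atTop univ :=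
  tendstoLocallyUniformlyOn_dampedF1 0 s (by linarith)

theorem tendstoLocallyUniformlyOn_dampedDen {s : ℂ} (hs : -(1 / 2 : ℝ) < s.re) :
    TendstoLocallyUniformlyOn (dampedDen s) (limitDen s) atTop univ := by
  have hc : 0 < 2 * s.re + 2 := by linarith
  have h1 : TendstoLocallyUniformlyOn (fun (_ : ℕ) (z : ℂ) => z) (fun z => z) atTop univ :=
    fun u hu x _ => ⟨univ, univ_mem, Eventually.of_forall fun _ _ _ => refl_mem_uniformity hu⟩
  exact h1.mul₀ (tendstoLocallyUniformlyOn_dampedF1 1 (s + 1) hc) continuousOn_id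
    (differentiable_oneF1 (s + 1) hc).continuous.continuousOn

theorem tendstoLocallyUniformlyOn_deriv_dampedNum {s : ℂ} (hs : -(1 / 2 : ℝ) < s.re) :
    TendstoLocallyUniformlyOn (fun n => deriv (dampedNum s n)) (deriv (limitNum s)) atTop univ :=
  (tendstoLocallyUniformlyOn_dampedNum hs).deriv
    (Eventually.of_forall fun n => (differentiable_dampedNum s n).differentiableOn) isOpen_univ

theorem tendstoLocallyUniformlyOn_deriv_dampedDen {s : ℂ} (hs : -(1 / 2 : ℝ) < s.re) :
    TendstoLocallyUniformlyOn (fun n => deriv (dampedDen s n)) (deriv (limitDen s)) atTop univ :=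
  (tendstoLocallyUniformlyOn_dampedDen hs).deriv
    (Eventually.of_forall fun n => (differentiable_dampedDen s n).differentiableOn) isOpen_univ

theorem continuous_deriv_of_differentiable {F : ℂ → ℂ} (hF : Differentiable ℂ F) :
    Continuous (deriv F) :=
  (hF.contDiff (n := 1)).continuous_deriv le_rfl

theorem two_mul_I_div_ne {x y : ℝ} (hx : 0 < x) (hy : 0 < y) (h : x ≠ y) :
    2 * I / (x : ℂ) ≠ 2 * I / y := by
  have hxC : (x : ℂ) ≠ 0 := ofReal_ne_zero.2 hx.ne'
  have hyC : (y : ℂ) ≠ 0 := ofReal_ne_zero.2 hy.ne'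
  intro h'
  rw [div_eq_div_iff hxC hyC] at h'
  have := mul_left_cancel₀ (by simp) h'
  exact h (by exact_mod_cast this.symm)

theorem tendsto_bezoutQuot {s : ℂ} (hs : -(1 / 2 : ℝ) < s.re) {x y : ℝ} (hx : 0 < x)
    (hy : 0 < y) :
    Tendsto (fun n => bezoutQuot (dampedNum s n) (dampedDen s n) (cayleyPoint n x)
      (cayleyPoint n y)) atTop
      (nhds (bezoutQuot (limitNum s) (limitDen s) (2 * I / x) (2 * I / y))) := by
  have hz := tendsto_cayleyPoint hx
  have hw := tendsto_cayleyPoint hy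
  have hF := differentiable_limitNum hs
  have hG := differentiable_limitDen hs
  have f1 := (tendstoLocallyUniformlyOn_dampedNum hs).tendsto_apply hF.continuous.continuousAt hz
  have g1 := (tendstoLocallyUniformlyOn_dampedDen hs).tendsto_apply hG.continuous.continuousAt hz
  rcases eq_or_ne x y with rfl | hxy
  · simp only [bezoutQuot_self]
    exact (((tendstoLocallyUniformlyOn_deriv_dampedNum hs).tendsto_apply
      (continuous_deriv_of_differentiable hF).continuousAt hz).mul g1).sub
      (((tendstoLocallyUniformlyOn_deriv_dampedDen hs).tendsto_apply
      (continuous_deriv_of_differentiable hG).continuousAt hz).mul f1)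
  · have f2 := (tendstoLocallyUniformlyOn_dampedNum hs).tendsto_apply
      hF.continuous.continuousAt hw
    have g2 := (tendstoLocallyUniformlyOn_dampedDen hs).tendsto_apply
      hG.continuous.continuousAt hw
    have hne := two_mul_I_div_ne hx hy hxy
    rw [bezoutQuot_of_ne _ _ hne]
    simp only [fun n => bezoutQuot_of_ne (dampedNum s n) (dampedDen s n) (cayleyPoint_ne n hxy)]
    exact ((f1.mul g2).sub (g1.mul f2)).div (hz.sub hw) (sub_ne_zero.2 hne)

theorem eventually_norm_bezoutQuot_le {s : ℂ} (hs : -(1 / 2 : ℝ) < s.re) (M : ℝ) :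
    ∃ B, 0 ≤ B ∧ ∀ᶠ n in atTop, ∀ z : ℂ, ‖z‖ ≤ M →
      ‖bezoutQuot (dampedNum s n) (dampedDen s n) z z‖ ≤ B := by
  have hF := differentiable_limitNum hs
  have hG := differentiable_limitDen hs
  obtain ⟨B₁, h1⟩ := (tendstoLocallyUniformlyOn_dampedNum hs).eventually_norm_le hF.continuous M
  obtain ⟨B₂, h2⟩ := (tendstoLocallyUniformlyOn_dampedDen hs).eventually_norm_le hG.continuous M
  obtain ⟨B₃, h3⟩ := (tendstoLocallyUniformlyOn_deriv_dampedNum hs).eventually_norm_le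
    (continuous_deriv_of_differentiable hF) M
  obtain ⟨B₄, h4⟩ := (tendstoLocallyUniformlyOn_deriv_dampedDen hs).eventually_norm_le
    (continuous_deriv_of_differentiable hG) M
  refine ⟨|B₃ * B₂ + B₄ * B₁|, abs_nonneg _, ?_⟩
  filter_upwards [h1, h2, h3, h4] with n h1 h2 h3 h4 z hz
  have h1 := h1 z hz
  have h2 := h2 z hz
  have h3 := h3 z hz
  have h4 := h4 z hz
  refine le_trans ?_ (le_abs_self _)
  rw [bezoutQuot_self]
  refine (norm_sub_le _ _).trans ?_
  rw [norm_mul, norm_mul]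
  have h5 := (norm_nonneg _).trans h3
  have h6 := (norm_nonneg _).trans h4
  gcongr

theorem Ptilde_of_pos (s : ℂ) {x : ℝ} (hx : 0 < x) :
    Ptilde s x = (((2 : ℝ) ^ s.re : ℝ) : ℂ) * (limitFactor s x * limitNum s (2 * I / x)) := by
  rw [Ptilde, prefac_of_pos s hx, limitNum, mul_assoc]

theorem Qfun_of_pos (s : ℂ) {x : ℝ} (hx : 0 < x) :
    Qfun s x =
      -I * (((2 : ℝ) ^ s.re : ℝ) : ℂ) * (limitFactor s x * limitDen s (2 * I / x)) := by
  rw [Qfun, prefac_of_pos s hx, limitDen]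
  linear_combination (-(2 / (x : ℂ)) * ((((2 : ℝ) ^ s.re : ℝ) : ℂ) * limitFactor s x) *
    oneF1 (s + 1) ((2 * s.re + 2 : ℝ) : ℂ) (2 * I / (x : ℂ))) * (-I_sq)

theorem differentiableAt_limitFactor (s : ℂ) {x : ℝ} (hx : 0 < x) :
    DifferentiableAt ℝ (limitFactor s) x := by
  have hxC : (x : ℂ) ≠ 0 := ofReal_ne_zero.2 hx.ne'
  have h1 : DifferentiableAt ℝ
      (fun x : ℝ => ((x ^ (-s.re) * Real.exp (s.im * (Real.pi / 2)) : ℝ) : ℂ)) x :=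
    ofRealCLM.differentiableAt.comp x
      ((Real.differentiableAt_rpow_const_of_ne _ hx.ne').mul_const _)
  have h2 : DifferentiableAt ℝ (fun x : ℝ => -I / (x : ℂ)) x :=
    (differentiableAt_const _).div ofRealCLM.differentiableAt hxC
  exact h1.mul h2.cexp

theorem deriv_limitFactor_mul (s : ℂ) {F : ℂ → ℂ} (hF : Differentiable ℂ F) {x : ℝ}
    (hx : 0 < x) :
    HasDerivAt (fun t : ℝ => limitFactor s t * F (2 * I / t))
      (deriv (limitFactor s) x * F (2 * I / x) +
        limitFactor s x * (deriv F (2 * I / x) * (I / 2 * (2 * I / x) ^ 2))) x := by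
  have hxC : (x : ℂ) ≠ 0 := ofReal_ne_zero.2 hx.ne'
  have h1 : HasDerivAt (fun t : ℝ => 2 * I / (t : ℂ)) (I / 2 * (2 * I / x) ^ 2) x := by
    have h := (hasDerivAt_const x (2 * I)).div (ofRealCLM.hasDerivAt (x := x)) hxC
    refine h.congr_deriv ?_
    simp only [ofRealCLM_apply, ofReal_one]
    field_simp
    linear_combination (-2 * I) * I_sq
  exact (differentiableAt_limitFactor s hx).hasDerivAt.mul
    (HasDerivAt.comp x (h₂ := F) (hF _).hasDerivAt h1)

theorem KinfC_of_pos {s : ℂ} (hs : -(1 / 2 : ℝ) < s.re) {x y : ℝ} (hx : 0 < x) (hy : 0 < y) :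
    KinfC s x y = limitConst s * (limitFactor s x * limitFactor s y) *
      (2 * I / x * (2 * I / y)) *
        bezoutQuot (limitNum s) (limitDen s) (2 * I / x) (2 * I / y) := by
  have h2 : (((2 : ℝ) ^ (2 * s.re) : ℝ) : ℂ) =
      (((2 : ℝ) ^ s.re : ℝ) : ℂ) * (((2 : ℝ) ^ s.re : ℝ) : ℂ) := by
    rw [← ofReal_mul, ← Real.rpow_add two_pos, two_mul]
  rw [limitConst, h2]
  rcases eq_or_ne x y with rfl | hxy
  · have hP : HasDerivAt (Ptilde s) _ x :=
      ((deriv_limitFactor_mul s (differentiable_limitNum hs) hx).const_mul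
        (((2 : ℝ) ^ s.re : ℝ) : ℂ)).congr_of_eventuallyEq (by
          filter_upwards [lt_mem_nhds hx] with t ht using Ptilde_of_pos s ht)
    have hQ : HasDerivAt (Qfun s) _ x :=
      ((deriv_limitFactor_mul s (differentiable_limitDen hs) hx).const_mul
        (-I * (((2 : ℝ) ^ s.re : ℝ) : ℂ))).congr_of_eventuallyEq (by
          filter_upwards [lt_mem_nhds hx] with t ht using Qfun_of_pos s ht)
    rw [KinfC, if_pos rfl, hP.deriv, hQ.deriv, Ptilde_of_pos s hx, Qfun_of_pos s hx,
      bezoutQuot_self]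
    generalize 2 * I / (x : ℂ) = ζ
    generalize (((2 : ℝ) ^ s.re : ℝ) : ℂ) = T
    generalize deriv (limitFactor s) x = l'
    generalize limitFactor s x = l
    generalize deriv (limitNum s) ζ = F'
    generalize deriv (limitDen s) ζ = G'
    linear_combination (-(cinf s * T ^ 2 * l ^ 2 * ζ ^ 2 / 2 *
      (F' * limitDen s ζ - G' * limitNum s ζ))) * I_sq
  · have hxC : (x : ℂ) ≠ 0 := ofReal_ne_zero.2 hx.ne'
    have hyC : (y : ℂ) ≠ 0 := ofReal_ne_zero.2 hy.ne'
    have hxyC : (x : ℂ) - y ≠ 0 := sub_ne_zero.2 (by exact_mod_cast hxy)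
    have hne := two_mul_I_div_ne hx hy hxy
    have hsub : 2 * I / (x : ℂ) - 2 * I / y = I / 2 * (2 * I / x * (2 * I / y)) * (x - y) := by
      field_simp
      linear_combination (-(x - y) : ℂ) * I_sq
    have hx0 : 2 * I / (x : ℂ) ≠ 0 := by simp [hxC]
    have hy0 : 2 * I / (y : ℂ) ≠ 0 := by simp [hyC]
    rw [KinfC, if_neg hxy, Ptilde_of_pos s hx, Qfun_of_pos s hx, Ptilde_of_pos s hy,
      Qfun_of_pos s hy, bezoutQuot_of_ne _ _ hne, hsub]
    generalize 2 * I / (x : ℂ) = ζ at *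
    generalize 2 * I / (y : ℂ) = η at *
    generalize (((2 : ℝ) ^ s.re : ℝ) : ℂ) = T
    field_simp
    rw [I_sq]
    ring

theorem tendsto_scaledKernel {s : ℂ} (hs : -(1 / 2 : ℝ) < s.re) {x y : ℝ} (hx : 0 < x)
    (hy : 0 < y) :
    Tendsto (fun n => scaledKernel s (n + 1) x y) atTop (nhds (Kinf s x y)) := by
  have h : Tendsto (fun n => (scaledKernel s (n + 1) x y : ℂ)) atTop (nhds (KinfC s x y)) := by
    rw [KinfC_of_pos hs hx hy]
    simp only [scaledKernel_eq hs]
    exact (((tendsto_scaledConst hs).mul ((tendsto_scaledFactor s hx).mul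
      (tendsto_scaledFactor s hy))).mul ((tendsto_cayleyPoint hx).mul
        (tendsto_cayleyPoint hy))).mul (tendsto_bezoutQuot hs hx hy)
  exact ((continuous_re.tendsto _).comp h).congr fun n => ofReal_re _

theorem eventually_scaledKernel_self_le {s : ℂ} (hs : -(1 / 2 : ℝ) < s.re) {x₀ : ℝ}
    (hx₀ : 0 < x₀) :
    ∃ C, 0 ≤ C ∧ ∀ᶠ n in atTop, ∀ x, x₀ < x →
      scaledKernel s (n + 1) x x ≤ C * x ^ (-2 * s.re - 2) := by
  obtain ⟨B, hB0, hB⟩ := eventually_norm_bezoutQuot_le hs (2 / x₀)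
  set A : ℝ := (1 + 1 / x₀ ^ 2) ^ |s.re| * Real.exp (2 * (|s.im| * Real.pi)) with hA
  have hA0 : 0 ≤ A := by positivity
  refine ⟨(‖limitConst s‖ + 1) * A * 4 * B, by positivity, ?_⟩
  have hconst : ∀ᶠ n in atTop, ‖scaledConst s n‖ < ‖limitConst s‖ + 1 :=
    (tendsto_scaledConst hs).norm.eventually_lt_const (lt_add_one _)
  filter_upwards [hB, hconst] with n hn hc x hx
  have hx' := hx₀.trans hx
  have h1 := norm_scaledFactor_sq_le s hx₀ n hx
  rw [← hA] at h1
  have h2 := norm_cayleyPoint_le n hx'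
  have h3 := hn (cayleyPoint n x) (h2.trans (by gcongr))
  calc scaledKernel s (n + 1) x x ≤ ‖(scaledKernel s (n + 1) x x : ℂ)‖ := by
        rw [norm_real]; exact le_abs_self _
    _ = ‖scaledConst s n‖ * ‖scaledFactor s n x‖ ^ 2 * ‖cayleyPoint n x‖ ^ 2 *
        ‖bezoutQuot (dampedNum s n) (dampedDen s n) (cayleyPoint n x) (cayleyPoint n x)‖ := by
        rw [scaledKernel_eq hs]
        simp only [norm_mul]
        ring
    _ ≤ (‖limitConst s‖ + 1) * (A * x ^ (-2 * s.re)) * (2 / x) ^ 2 * B := by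
        have := hc.le
        gcongr
    _ = (‖limitConst s‖ + 1) * A * 4 * B * x ^ (-2 * s.re - 2) := by
        rw [Real.rpow_sub hx', Real.rpow_two]
        ring

theorem tendsto_fredholmDet {K : ℕ → ℝ → ℝ → ℝ} {L : ℝ → ℝ → ℝ} {t : ℝ} {φ : ℝ → ℝ}
    (hcont : ∀ n, Continuous fun p : ℝ × ℝ => K n p.1 p.2)
    (hlim : ∀ x y, t < x → t < y → Tendsto (fun n => K n x y) atTop (nhds (L x y)))
    (hdet : ∀ n (k : ℕ) (x : Fin k → ℝ),
      0 ≤ rhoK (K n) k x ∧ rhoK (K n) k x ≤ ∏ a, K n (x a) (x a))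
    (hφ : IntegrableOn φ (Ioi t)) (hle : ∀ᶠ n in atTop, ∀ x, t < x → K n x x ≤ φ x) :
    Tendsto (fun n => fredholmDet (K n) t) atTop (nhds (fredholmDet L t)) := by
  have hself : ∀ n x, 0 ≤ K n x x := by
    intro n x
    have := (hdet n 1 fun _ => x).1
    simpa [rhoK] using this
  have hrestrict : ∀ k : ℕ, (volume : Measure (Fin k → ℝ)).restrict (univ.pi fun _ => Ioi t) =
      Measure.pi fun _ => (volume : Measure ℝ).restrict (Ioi t) := by
    intro k
    rw [volume_pi, Measure.restrict_pi_pi]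
  have hmem : ∀ k : ℕ, ∀ᵐ x ∂(volume : Measure (Fin k → ℝ)).restrict (univ.pi fun _ => Ioi t),
      ∀ a, t < x a := by
    intro k
    filter_upwards [ae_restrict_mem (MeasurableSet.univ_pi fun _ => measurableSet_Ioi)] with x hx a
    exact hx a (mem_univ a)
  have hint : ∀ k : ℕ, IntegrableOn (fun x : Fin k → ℝ => ∏ a, φ (x a))
      (univ.pi fun _ => Ioi t) := by
    intro k
    rw [IntegrableOn, hrestrict]
    exact Integrable.fintype_prod fun _ => hφ
  have hbound : ∀ᶠ n in atTop, ∀ (k : ℕ) (x : Fin k → ℝ), (∀ a, t < x a) →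
      ‖rhoK (K n) k x‖ ≤ ∏ a, φ (x a) := by
    filter_upwards [hle] with n hn k x hx
    rw [Real.norm_of_nonneg (hdet n k x).1]
    exact (hdet n k x).2.trans (Finset.prod_le_prod (fun a _ => hself n _) fun a _ => hn _ (hx a))
  have hrho : ∀ n k, Continuous fun x : Fin k → ℝ => rhoK (K n) k x := by
    intro n k
    refine Continuous.matrix_det ?_
    refine continuous_matrix fun i j => ?_
    have h : Continuous fun x : Fin k → ℝ => (x i, x j) := by fun_prop
    exact (hcont n).comp h
  refine Tendsto.const_add 1 ?_
  refine tendsto_tsum_of_dominated_convergence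
    (bound := fun k => (∫ x in Ioi t, φ x) ^ (k + 1) / (k + 1).factorial)
    ((summable_nat_add_iff 1).2 (Real.summable_pow_div_factorial _)) (fun k => ?_) ?_
  · refine Tendsto.const_mul _ ?_
    refine tendsto_integral_filter_of_dominated_convergence (fun x => ∏ a, φ (x a))
      (Eventually.of_forall fun n => (hrho n _).aestronglyMeasurable) ?_ (hint _) ?_
    · filter_upwards [hbound] with n hn
      filter_upwards [hmem (k + 1)] with x hx using hn _ x hx
    · filter_upwards [hmem (k + 1)] with x hx
      have h1 : Tendsto (fun n => Matrix.of fun i j => K n (x i) (x j)) atTop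
          (nhds (Matrix.of fun i j => L (x i) (x j))) :=
        tendsto_pi_nhds.2 fun i => tendsto_pi_nhds.2 fun j => hlim _ _ (hx i) (hx j)
      exact (continuous_id.matrix_det.tendsto _).comp h1
  · filter_upwards [hbound] with n hn k
    have h1 : ‖∫ x : Fin (k + 1) → ℝ in univ.pi fun _ => Ioi t, rhoK (K n) (k + 1) x‖ ≤
        (∫ x in Ioi t, φ x) ^ (k + 1) := by
      refine (norm_integral_le_of_norm_le (hint (k + 1)) ?_).trans (le_of_eq ?_)
      · filter_upwards [hmem (k + 1)] with x hx using hn _ x hx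
      · rw [hrestrict, integral_fintype_prod_eq_pow, Fintype.card_fin]
    rw [norm_mul, norm_div, norm_pow, norm_neg, norm_one, one_pow, RCLike.norm_natCast, one_div,
      ← div_eq_inv_mul]
    gcongr

/-- The distribution function of the rescaled largest eigenvalue of the
generalized Cauchy ensemble converges to the Fredholm determinant `F_∞`: for every `x₀ > 0`,
`P[λ₁(N)/N ≤ x₀] → F_∞(x₀)` as `N → ∞`, the probability being the ratio of the integral of
the eigenvalue density over `(−∞, N·x₀)^N` to the integral over `ℝ^N`. -/
theorem largest_eigenvalue_scaling_limit (s : ℂ) (hs : -(1 / 2 : ℝ) < s.re)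
    (x₀ : ℝ) (hx₀ : 0 < x₀) :
    Filter.Tendsto
      (fun N : ℕ =>
        (∫ x : Fin N → ℝ in Set.univ.pi fun _ => Set.Iio ((N : ℝ) * x₀),
            vandSq N x * ∏ j, wH s N (x j)) /
          ∫ x : Fin N → ℝ, vandSq N x * ∏ j, wH s N (x j))
      Filter.atTop (nhds (fredholmDet (Kinf s) x₀)) := by
  rw [← tendsto_add_atTop_iff_nat 1]
  simp only [ratio_eq_fredholmDet hs]
  obtain ⟨C, -, hle⟩ := eventually_scaledKernel_self_le hs hx₀
  exact tendsto_fredholmDet (fun n => continuous_scaledKernel s (n + 1))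
    (fun x y hx hy => tendsto_scaledKernel hs (hx₀.trans hx) (hx₀.trans hy))
    (fun n k x => det_scaledKernel_nonneg_le hs (n + 1) x)
    ((integrableOn_Ioi_rpow_of_lt (by linarith) hx₀).const_mul C) hle
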